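/- Let A be a finite unital C*-algebra. Then A is an AW*-algebra if and only if: for every family {x_i}_{i∈Γ} of mutually orthogonal elements of A and every inner ideal J ⊆ A such that A(x_i) is orthogonal to J for all i ∈ Γ, there exists a partial isometry e ∈ A satisfying J ⊆ A₂(e) and A(x_i) ⊆ A₀(e) for all i ∈ Γ. -/

import Mathlib

universe u

/-- A projection in a C*-algebra: a self-adjoint idempotent. -/
def IsProjection {A : Type*} [Mul A] [Star A] (p : A) : Prop :=
  star p = p ∧ p * p = p

/-- A partial isometry: an element `e` such that `e * e*` is a projection. -/
def IsPartialIsometry {A : Type*} [Mul A] [Star A] (e : A) : Prop :=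
  IsProjection (e * star e)

/-- A unital C*-algebra is finite if every projection Murray–von Neumann equivalent
to the unit equals the unit. -/
def IsFiniteCStar (A : Type*) [CStarAlgebra A] : Prop :=
  ∀ p : A, IsProjection p → (∃ e : A, e * star e = p ∧ star e * e = 1) → p = 1

/-- A C*-algebra is an AW*-algebra if the right annihilator of every nonempty subset is
of the form `p A` for a projection `p`. -/
def IsAWStar (A : Type*) [CStarAlgebra A] : Prop :=
  ∀ S : Set A, S.Nonempty → ∃ p : A, IsProjection p ∧
    {y : A | ∀ s ∈ S, s * y = 0} = {z : A | ∃ a : A, z = p * a}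

/-- The Peirce-2 subspace associated with a partial isometry `e`. -/
def Peirce2 {A : Type*} [Mul A] [Star A] (e : A) : Set A :=
  {z : A | e * star e * z * (star e * e) = z}

/-- The Peirce-0 subspace associated with a partial isometry `e`. -/
def Peirce0 {A : Type*} [Mul A] [Star A] [Zero A] (e : A) : Set A :=
  {z : A | e * star e * z = 0 ∧ z * (star e * e) = 0}

/-- Orthogonality of elements in a C*-algebra: `a ⊥ b` iff `a b* = 0` and `b* a = 0`. -/
def Orthog {A : Type*} [Mul A] [Star A] [Zero A] (a b : A) : Prop :=
  a * star b = 0 ∧ star b * a = 0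

/-- A linear subspace `J` is an inner ideal if `x a y ∈ J` for all `x, y ∈ J`, `a ∈ A`. -/
def IsInnerIdeal {A : Type*} [CStarAlgebra A] (J : Submodule ℂ A) : Prop :=
  ∀ x ∈ J, ∀ y ∈ J, ∀ a : A, x * a * y ∈ J

/-- The inner ideal of `A` generated by `x`: the norm closure of `x A x`. -/
def innerIdealGen {A : Type*} [CStarAlgebra A] (x : A) : Set A :=
  closure {z : A | ∃ a : A, z = x * a * x}

/-- Murray–von Neumann equivalence. -/
def MvNEquiv {A : Type*} [Mul A] [Star A] (p q : A) : Prop :=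
  ∃ e : A, e * star e = p ∧ star e * e = q

/-- `p` is the right support projection of the family `w`. -/
def IsRightSupport {A : Type*} [CStarAlgebra A] {ι : Type*} (w : ι → A) (p : A) : Prop :=
  IsProjection p ∧ ∀ y, p * y = 0 ↔ ∀ i, w i * y = 0

/-- `p` is the left support projection of the family `w`. -/
def IsLeftSupport {A : Type*} [CStarAlgebra A] {ι : Type*} (w : ι → A) (p : A) : Prop :=
  IsRightSupport (fun i => star (w i)) p

/-- A family of pairwise orthogonal partial isometries. -/
structure OrthPartialIsometries {A : Type*} [CStarAlgebra A] {ι : Type*} (w : ι → A) :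
    Prop where
  mul_star_mul : ∀ i, w i * star (w i) * w i = w i
  orthog : ∀ i j, i ≠ j → Orthog (w i) (w j)

/-- A projection commuting with everything. -/
structure IsCentralProjection {A : Type*} [CStarAlgebra A] (h : A) : Prop where
  isProjection : IsProjection h
  comm : ∀ a, h * a = a * h

section Basic

variable {A : Type*} [CStarAlgebra A]

theorem IsProjection.one_sub {p : A} (hp : IsProjection p) : IsProjection (1 - p) := by
  obtain ⟨h1, h2⟩ := hp
  refine ⟨by simp [h1], ?_⟩
  grind [mul_sub, sub_mul, mul_add, add_mul]

theorem IsCentralProjection.one_sub {h : A} (hh : IsCentralProjection h) :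
    IsCentralProjection (1 - h) :=
  ⟨hh.1.one_sub, fun a => by have := hh.2 a; grind [mul_sub, sub_mul, mul_add, add_mul]⟩

theorem IsProjection.mul_of_comm {p q : A} (hp : IsProjection p) (hq : IsProjection q)
    (h : p * q = q * p) : IsProjection (p * q) := by
  obtain ⟨h1, h2⟩ := hp
  obtain ⟨h3, h4⟩ := hq
  refine ⟨by simp [h1, h3, h], ?_⟩
  grind [mul_sub, sub_mul, mul_add, add_mul]

theorem IsProjection.add {p q : A} (hp : IsProjection p) (hq : IsProjection q)
    (h : p * q = 0) : IsProjection (p + q) := by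
  have h' : q * p = 0 := by
    have := congrArg star h
    simpa [hp.1, hq.1] using this
  obtain ⟨h1, h2⟩ := hp
  obtain ⟨h3, h4⟩ := hq
  refine ⟨by simp [h1, h3], ?_⟩
  grind [mul_sub, sub_mul, mul_add, add_mul]

theorem mul_eq_zero_of_mul_eq_zero {x p q y : A} (hx : x * p = x) (hy : q * y = y)
    (h : p * q = 0) : x * y = 0 := by
  rw [← hx, ← hy, mul_assoc, ← mul_assoc p, h, zero_mul, mul_zero]

theorem mul_eq_zero_of_selfAdjoint {x y : A} (hx : star x = x) (hy : star y = y)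
    (h : x * y = 0) : y * x = 0 := by
  have := congrArg star h
  simpa [hx, hy] using this

theorem mul_eq_left_of_mul_eq_right {p q : A} (hp : star p = p) (hq : star q = q)
    (h : q * p = p) : p * q = p := by
  have := congrArg star h
  simpa [hp, hq] using this

theorem star_mul_star_mul {w : A} (h : w * star w * w = w) :
    star w * w * star w = star w := by
  have := congrArg star h
  simpa [mul_assoc] using this

theorem isProjection_star_mul {w : A} (h : w * star w * w = w) :
    IsProjection (star w * w) := by
  refine ⟨by simp, ?_⟩
  grind [mul_sub, sub_mul, mul_add, add_mul]

theorem mul_star_mul_of_isProjection_star_mul {w : A} (h : IsProjection (star w * w)) :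
    w * star w * w = w := by
  have h2 := h.2
  have : star (w * star w * w - w) * (w * star w * w - w) = 0 := by
    simp only [star_sub, star_mul, star_star]
    grind [mul_sub, sub_mul, mul_add, add_mul]
  rw [CStarRing.star_mul_self_eq_zero_iff] at this
  exact sub_eq_zero.mp this

theorem mul_star_mul_of_isProjection_mul_star {w : A} (h : IsProjection (w * star w)) :
    w * star w * w = w := by
  have := mul_star_mul_of_isProjection_star_mul (w := star w) (by simpa using h)
  have := star_mul_star_mul this
  simpa using this

theorem MvNEquiv.symm {p q : A} (h : MvNEquiv p q) : MvNEquiv q p := by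
  obtain ⟨e, h1, h2⟩ := h
  exact ⟨star e, by simpa using h2, by simpa using h1⟩

theorem IsProjection.mvnEquiv_refl {p : A} (hp : IsProjection p) : MvNEquiv p p :=
  ⟨p, by rw [hp.1, hp.2], by rw [hp.1, hp.2]⟩

theorem MvNEquiv.exists_partialIsometry {p q : A} (h : MvNEquiv p q) (hp : IsProjection p) :
    ∃ e : A, e * star e = p ∧ star e * e = q ∧ p * e = e ∧ e * q = e ∧
      q * star e = star e ∧ star e * p = star e := by
  obtain ⟨e, rfl, rfl⟩ := h
  have h1 := mul_star_mul_of_isProjection_mul_star hp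
  have h2 := star_mul_star_mul h1
  exact ⟨e, rfl, rfl, h1, by rw [← mul_assoc, h1], h2, by rw [← mul_assoc, h2]⟩

theorem MvNEquiv.isProjection_right {p q : A} (h : MvNEquiv p q) (hp : IsProjection p) :
    IsProjection q := by
  obtain ⟨e, rfl, rfl⟩ := h
  exact isProjection_star_mul (mul_star_mul_of_isProjection_mul_star hp)

theorem MvNEquiv.trans {p q r : A} (hp : IsProjection p) (h : MvNEquiv p q)
    (h' : MvNEquiv q r) : MvNEquiv p r := by
  have hq := h.isProjection_right hp
  obtain ⟨e, e1, e2, e3, e4, e5, e6⟩ := h.exists_partialIsometry hp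
  obtain ⟨d, d1, d2, d3, d4, d5, d6⟩ := h'.exists_partialIsometry hq
  refine ⟨e * d, ?_, ?_⟩ <;> simp only [star_mul] <;> grind [mul_sub, sub_mul, mul_add, add_mul]

theorem MvNEquiv.add {p₁ q₁ p₂ q₂ : A} (hp₁ : IsProjection p₁) (hp₂ : IsProjection p₂)
    (h₁ : MvNEquiv p₁ q₁) (h₂ : MvNEquiv p₂ q₂) (hp : p₁ * p₂ = 0) (hq : q₁ * q₂ = 0) :
    MvNEquiv (p₁ + p₂) (q₁ + q₂) := by
  have hp' := mul_eq_zero_of_selfAdjoint hp₁.1 hp₂.1 hp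
  have hq' := mul_eq_zero_of_selfAdjoint (h₁.isProjection_right hp₁).1
    (h₂.isProjection_right hp₂).1 hq
  obtain ⟨e, e1, e2, e3, e4, e5, e6⟩ := h₁.exists_partialIsometry hp₁
  obtain ⟨d, d1, d2, d3, d4, d5, d6⟩ := h₂.exists_partialIsometry hp₂
  have a1 : e * star d = 0 := mul_eq_zero_of_mul_eq_zero e4 d5 hq
  have a2 : d * star e = 0 := mul_eq_zero_of_mul_eq_zero d4 e5 hq'
  have a3 : star e * d = 0 := mul_eq_zero_of_mul_eq_zero e6 d3 hp
  have a4 : star d * e = 0 := mul_eq_zero_of_mul_eq_zero d6 e3 hp'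
  refine ⟨e + d, ?_, ?_⟩ <;> simp only [star_add] <;> grind [mul_sub, sub_mul, mul_add, add_mul]

theorem MvNEquiv.central_mul {p q h : A} (hpq : MvNEquiv p q) (hh : IsCentralProjection h) :
    MvNEquiv (h * p) (h * q) := by
  obtain ⟨e, e1, e2⟩ := hpq
  refine ⟨h * e, ?_, ?_⟩ <;> simp only [star_mul, hh.1.1]
  · calc h * e * (star e * h) = h * (e * star e * h) := by simp only [mul_assoc]
      _ = h * p := by rw [e1, ← hh.2 p, ← mul_assoc, hh.1.2]
  · calc star e * h * (h * e) = star e * (h * h) * e := by simp only [mul_assoc]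
      _ = h * q := by rw [hh.1.2, ← hh.2, mul_assoc, e2]

theorem MvNEquiv.exists_sub {p q p' : A} (hp : IsProjection p) (h : MvNEquiv p q)
    (hp' : IsProjection p') (hle : p * p' = p') :
    ∃ q', IsProjection q' ∧ MvNEquiv p' q' ∧ q * q' = q' := by
  obtain ⟨e, e1, e2, e3, e4, e5, e6⟩ := h.exists_partialIsometry hp
  have hle' := mul_eq_left_of_mul_eq_right hp'.1 hp.1 hle
  have h2 := hp'.2
  have : MvNEquiv p' (star e * p' * e) := by
    refine ⟨p' * e, ?_, ?_⟩ <;> simp only [star_mul, hp'.1] <;>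
      grind [mul_sub, sub_mul, mul_add, add_mul]
  refine ⟨star e * p' * e, this.isProjection_right hp', this, ?_⟩
  grind [mul_sub, sub_mul, mul_add, add_mul]

theorem IsFiniteCStar.eq_of_mvnEquiv (hfin : IsFiniteCStar A) {p q : A} (hp : IsProjection p)
    (hq : IsProjection q) (h : MvNEquiv p q) (hle : p * q = q) : q = p := by
  have hle' := mul_eq_left_of_mul_eq_right hq.1 hp.1 hle
  have h2 : MvNEquiv (p + (1 - p)) (q + (1 - p)) :=
    h.add hp hp.one_sub hp.one_sub.mvnEquiv_refl
      (by have := hp.2; grind [mul_sub, sub_mul, mul_add, add_mul])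
      (by grind [mul_sub, sub_mul, mul_add, add_mul])
  have h3 := hfin _ (hq.add hp.one_sub (by grind [mul_sub, sub_mul, mul_add, add_mul]))
    (by simpa [MvNEquiv] using h2.symm)
  grind [mul_sub, sub_mul, mul_add, add_mul]

theorem IsRightSupport.mul_self {ι : Type*} {w : ι → A} {p : A} (h : IsRightSupport w p)
    (i : ι) : w i * p = w i := by
  have := (h.2 (1 - p)).1 (by have := h.1.2; grind [mul_sub, sub_mul, mul_add, add_mul]) i
  grind [mul_sub, sub_mul, mul_add, add_mul]

theorem IsLeftSupport.self_mul {ι : Type*} {w : ι → A} {p : A} (h : IsLeftSupport w p)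
    (i : ι) : p * w i = w i := by
  have := congrArg star (h.mul_self i)
  simpa [h.1.1] using this

theorem IsRightSupport.unique {ι κ : Type*} {w : ι → A} {w' : κ → A} {p p' : A}
    (h : IsRightSupport w p) (h' : IsRightSupport w' p')
    (hw : ∀ y, (∀ i, w i * y = 0) ↔ ∀ j, w' j * y = 0) : p = p' := by
  have h1 : p * (1 - p') = 0 := by
    rw [h.2, hw, ← h'.2]
    have := h'.1.2
    grind [mul_sub, sub_mul, mul_add, add_mul]
  have h2 : p' * (1 - p) = 0 := by
    rw [h'.2, ← hw, ← h.2]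
    have := h.1.2
    grind [mul_sub, sub_mul, mul_add, add_mul]
  have h3 := mul_eq_left_of_mul_eq_right h'.1.1 h.1.1 (p := p') (q := p)
  have h4 := mul_eq_left_of_mul_eq_right h.1.1 h'.1.1 (p := p) (q := p')
  have h5 : star (p * p') = star p := by congr 1; grind [mul_sub, sub_mul, mul_add, add_mul]
  simp only [star_mul, h.1.1, h'.1.1] at h5
  grind [mul_sub, sub_mul, mul_add, add_mul]

theorem IsAWStar.exists_isRightSupport (hA : IsAWStar A) {ι : Type*} (w : ι → A) :
    ∃ p, IsRightSupport w p := by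
  obtain ⟨p, hp, h⟩ := hA (insert 0 (Set.range w)) ⟨0, by simp⟩
  refine ⟨1 - p, hp.one_sub, fun y => ?_⟩
  have := Set.ext_iff.1 h y
  simp only [Set.mem_ofPred_eq, Set.mem_insert_iff, Set.mem_range, forall_eq_or_imp, zero_mul,
    true_and, forall_exists_index, forall_apply_eq_imp_iff] at this
  rw [this]
  constructor
  · intro hy
    exact ⟨y, by grind [mul_sub, sub_mul, mul_add, add_mul]⟩
  · rintro ⟨a, rfl⟩
    have := hp.2
    grind [mul_sub, sub_mul, mul_add, add_mul]

theorem IsAWStar.exists_isLeftSupport (hA : IsAWStar A) {ι : Type*} (w : ι → A) :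
    ∃ p, IsLeftSupport w p :=
  hA.exists_isRightSupport _

theorem OrthPartialIsometries.star_family {ι : Type*} {w : ι → A} (hw : OrthPartialIsometries w) :
    OrthPartialIsometries fun i => star (w i) where
  mul_star_mul i := by simpa using star_mul_star_mul (hw.1 i)
  orthog i j hij := by
    obtain ⟨h1, h2⟩ := hw.2 i j hij
    constructor
    · simpa using congrArg Star.star h2
    · simpa using congrArg Star.star h1

theorem IsRightSupport.isLeftSupport_star {ι : Type*} {w : ι → A} {p : A}
    (h : IsRightSupport w p) : IsLeftSupport (fun i => star (w i)) p := by
  simpa [IsLeftSupport] using h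

/-- A maximal pairwise related set of elements satisfying a predicate. -/
theorem exists_maximal_pairwise {α : Type*} (Q : α → Prop) (R : α → α → Prop)
    (hR : ∀ x y, R x y → R y x) :
    ∃ V : Set α, (∀ v ∈ V, Q v) ∧ V.Pairwise R ∧
      ∀ x, Q x → (∀ v ∈ V, R x v) → x ∈ V := by
  obtain ⟨V, hV⟩ := zorn_subset {V : Set α | (∀ v ∈ V, Q v) ∧ V.Pairwise R} (by
    intro c hc hchain
    refine ⟨⋃₀ c, ⟨?_, ?_⟩, fun s hs => Set.subset_sUnion_of_mem hs⟩
    · rintro v ⟨s, hs, hv⟩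
      exact (hc hs).1 v hv
    · exact (Set.pairwise_sUnion hchain.directedOn).2 fun s hs => (hc hs).2)
  refine ⟨V, hV.prop.1, hV.prop.2, fun x hx hxV => ?_⟩
  have hins : insert x V ∈ {V : Set α | (∀ v ∈ V, Q v) ∧ V.Pairwise R} := by
    refine ⟨?_, ?_⟩
    · rintro v (rfl | hv)
      · exact hx
      · exact hV.prop.1 v hv
    · exact hV.prop.2.insert fun b hb _ => ⟨hxV b hb, hR _ _ (hxV b hb)⟩
  exact hV.le_of_ge hins (Set.subset_insert x V) (Set.mem_insert x V)

end Basic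

section Additivity

variable {A : Type*} [CStarAlgebra A]

theorem IsRightSupport.mul_star_eq {ι : Type*} {w : ι → A} {p : A} (h : IsRightSupport w p)
    (i : ι) : p * star (w i) = star (w i) := by
  have := congrArg star (h.mul_self i)
  simpa [h.1.1] using this

theorem IsLeftSupport.star_mul_eq {ι : Type*} {w : ι → A} {p : A} (h : IsLeftSupport w p)
    (i : ι) : star (w i) * p = star (w i) :=
  IsRightSupport.mul_self h i

/-- Orthogonal partial isometries with orthogonal left and right supports are addable. -/
theorem OrthPartialIsometries.mvnEquiv_of_mul_eq_zero (hA : IsAWStar A) {ι : Type*}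
    {w : ι → A} (hw : OrthPartialIsometries w) {e f : A} (he : IsLeftSupport w e)
    (hf : IsRightSupport w f) (hef : e * f = 0) : MvNEquiv e f := by
  have hfe : f * e = 0 := mul_eq_zero_of_selfAdjoint he.1.1 hf.1.1 hef
  have hww : ∀ i j, w i * w j = 0 := fun i j =>
    mul_eq_zero_of_mul_eq_zero (hf.mul_self i) (he.self_mul j) hfe
  have hss : ∀ i j, star (w i) * star (w j) = 0 := fun i j => by
    rw [← star_mul, hww, star_zero]
  have hss' : ∀ i j x, star (w i) * (star (w j) * x) = 0 := fun i j x => by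
    rw [← mul_assoc, hss, zero_mul]
  have hws : ∀ i j, i ≠ j → w i * star (w j) = 0 := fun i j h => (hw.2 i j h).1
  have hsw : ∀ i j, i ≠ j → star (w i) * w j = 0 := fun i j h => (hw.2 j i h.symm).2
  have hws' : ∀ i j x, i ≠ j → w i * (star (w j) * x) = 0 := fun i j x h => by
    rw [← mul_assoc, hws i j h, zero_mul]
  have h1 : ∀ i, w i * (star (w i) * w i) = w i := fun i => by rw [← mul_assoc, hw.1]
  have h2 : ∀ i, star (w i) * (w i * star (w i)) = star (w i) := fun i => by
    rw [← mul_assoc, star_mul_star_mul (hw.1 i)]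
  obtain ⟨G, hG⟩ := hA.exists_isRightSupport
    (fun i => w i * star (w i) + star (w i) * w i + w i + star (w i))
  have hGw : ∀ i, G * w i = G * (star (w i) * w i) := by
    intro i
    have : G * (star (w i) * w i - w i) = 0 := by
      rw [hG.2]
      intro j
      by_cases hij : j = i
      · subst hij
        simp only [mul_assoc, mul_sub, add_mul, hww, hss', h1, mul_zero]
        abel
      · simp [mul_assoc, mul_sub, add_mul, hww, hss', hws' j i _ hij, hsw j i hij]
    rw [mul_sub, sub_eq_zero] at this
    exact this.symm
  have hGg : ∀ i, G * (star (w i) * w i + w i) = star (w i) * w i + w i := by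
    intro i
    have := hG.mul_star_eq i
    simp only [star_add, star_mul, star_star] at this
    have := congrArg (· * (star (w i) * w i)) this
    simp only [mul_assoc, add_mul, hss', h1, mul_zero, zero_add, add_zero] at this
    rw [this]
  have hGf : ∀ i, (G + G) * (star (w i) * w i) = star (w i) * w i + w i := fun i => by
    rw [← hGg i, mul_add, hGw, add_mul]
  have hGe : ∀ i, (G + G) * (w i * star (w i)) = star (w i) + w i * star (w i) := fun i => by
    have : (G + G) * w i = star (w i) * w i + w i := by rw [← hGf i, add_mul, hGw, add_mul]
    rw [← mul_assoc, this, add_mul, mul_assoc, h2]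
  set u := e * (G + G) * f with hu
  have hus : star u = f * (G + G) * e := by
    simp [hu, he.1.1, hf.1.1, hG.1.1, mul_assoc]
  have huf : ∀ i, u * (star (w i) * w i) = w i := by
    intro i
    calc u * (star (w i) * w i) = e * ((G + G) * (f * star (w i) * w i)) := by
          simp only [hu, mul_assoc]
      _ = w i := by
        rw [hf.mul_star_eq, hGf, mul_add, he.self_mul, ← mul_assoc,
          mul_eq_zero_of_mul_eq_zero he.1.2 (hf.mul_star_eq i) hef, zero_mul, zero_add]
  have hue : ∀ i, star u * (w i * star (w i)) = star (w i) := by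
    intro i
    calc star u * (w i * star (w i)) = f * ((G + G) * (e * w i * star (w i))) := by
          simp only [hus, mul_assoc]
      _ = star (w i) := by
        rw [he.self_mul, hGe, mul_add, hf.mul_star_eq, ← mul_assoc,
          mul_eq_zero_of_mul_eq_zero hf.1.2 (he.self_mul i) hfe, zero_mul, add_zero]
  have huw : ∀ i, star u * w i = star (w i) * w i := fun i => by
    rw [← hue i, mul_assoc, mul_assoc, h1]
  have hus' : ∀ i, u * star (w i) = w i * star (w i) := fun i => by
    have := congrArg (· * star (w i)) (huf i)
    simpa only [mul_assoc, h2] using this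
  refine ⟨u, ?_, ?_⟩
  · have : e * (u * star u - 1) = 0 := by
      rw [he.2]
      intro i
      have h3 : u * star u * w i = w i := by rw [mul_assoc, huw, huf]
      have := congrArg star h3
      simp only [star_mul, star_star] at this
      rw [mul_sub, mul_one, this, sub_self]
    rw [mul_sub, mul_one, sub_eq_zero, hu] at this
    rw [← this, ← hu, ← mul_assoc, hu]
    simp only [← mul_assoc, he.1.2]
  · have : f * (star u * u - 1) = 0 := by
      rw [hf.2]
      intro i
      have h3 : star u * u * star (w i) = star (w i) := by rw [mul_assoc, hus', hue]
      have := congrArg star h3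
      simp only [star_mul, star_star] at this
      rw [mul_sub, mul_one, this, sub_self]
    rw [mul_sub, mul_one, sub_eq_zero, hus] at this
    rw [← this, hus]
    simp only [← mul_assoc, hf.1.2]

/-- Addability when the right support is equivalent to a projection orthogonal to the left
support. -/
theorem OrthPartialIsometries.mvnEquiv_of_exists (hA : IsAWStar A) {ι : Type*}
    {w : ι → A} (hw : OrthPartialIsometries w) {e f t : A} (he : IsLeftSupport w e)
    (hf : IsRightSupport w f) (hft : MvNEquiv f t) (het : e * t = 0) : MvNEquiv e f := by
  obtain ⟨v, v1, v2, v3, v4, v5, v6⟩ := hft.exists_partialIsometry hf.1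
  have ht := hft.isProjection_right hf.1
  refine MvNEquiv.trans he.1 ?_ hft.symm
  have h3 : ∀ i, w i * v * star (w i * v) = w i * star (w i) := fun i => by
    calc w i * v * star (w i * v) = w i * (v * star v) * star (w i) := by
          simp only [star_mul, mul_assoc]
      _ = _ := by rw [v1, hf.mul_self]
  refine OrthPartialIsometries.mvnEquiv_of_mul_eq_zero hA (w := fun i => w i * v)
    ⟨fun i => ?_, fun i j hij => ⟨?_, ?_⟩⟩ ⟨he.1, fun y => ?_⟩ ⟨ht, fun y => ?_⟩ het
  · rw [h3, ← mul_assoc, hw.1]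
  · calc w i * v * star (w j * v) = w i * (v * star v) * star (w j) := by
          simp only [star_mul, mul_assoc]
      _ = 0 := by rw [v1, hf.mul_self, (hw.2 i j hij).1]
  · simp only [star_mul]
    rw [mul_assoc, ← mul_assoc _ (w i), (hw.2 i j hij).2, zero_mul, mul_zero]
  · rw [he.2]
    refine forall_congr' fun i => ⟨fun h => ?_, fun h => ?_⟩
    · change star (w i * v) * y = 0
      change star (w i) * y = 0 at h
      rw [star_mul, mul_assoc, h, mul_zero]
    change star (w i * v) * y = 0 at h
    change star (w i) * y = 0
    have : v * (star (w i * v) * y) = star (w i) * y := by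
      calc v * (star (w i * v) * y) = v * star v * star (w i) * y := by
            simp only [star_mul, mul_assoc]
        _ = _ := by rw [v1, hf.mul_star_eq]
    rw [← this, h, mul_zero]
  · have : t * y = 0 ↔ f * (v * y) = 0 := by
      rw [← mul_assoc, v3]
      constructor
      · intro h
        rw [← v4, mul_assoc, h, mul_zero]
      · intro h
        rw [← v2, mul_assoc, h, mul_zero]
    rw [this, hf.2]
    simp only [mul_assoc]

end Additivity

section Cutdown

variable {A : Type*} [CStarAlgebra A]

theorem IsRightSupport.commute {ι : Type*} {w : ι → A} {p z : A} (hp : IsRightSupport w p)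
    (hz : star z = z) (hwz : ∀ i, Commute (w i) z) : Commute p z := by
  have h1 : p * (z * (1 - p)) = 0 := by
    rw [hp.2]
    intro i
    rw [← mul_assoc, (hwz i).eq, mul_assoc, mul_sub, mul_one, hp.mul_self, sub_self, mul_zero]
  have h2 : p * z = p * z * p := by
    rw [mul_sub, mul_one, mul_sub, sub_eq_zero] at h1
    rw [mul_assoc, ← h1]
  have h3 := congrArg star h2
  simp only [star_mul, hp.1.1, hz] at h3
  rw [Commute, SemiconjBy, h2, h3, mul_assoc]

theorem isRightSupport_unit {x p : A} :
    IsRightSupport (fun _ : Unit => x) p ↔ IsProjection p ∧ ∀ y, p * y = 0 ↔ x * y = 0 := by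
  simp [IsRightSupport]

/-- Every nonzero element of an AW*-algebra admits a nonzero spectral cutdown of its polar
decomposition. -/
theorem IsAWStar.exists_partialIsometry_of_ne_zero (hA : IsAWStar A) {x : A} (hx : x ≠ 0) :
    ∃ w : A, w ≠ 0 ∧ w * star w * w = w ∧ (∃ a, w = x * a) ∧ (∃ a, w = a * x) ∧
      w * star w * x = x * (star w * w) := by
  have hb : IsSelfAdjoint (star x * x) := IsSelfAdjoint.star_mul_self x
  set b := star x * x with hbx
  have hb0 : b ≠ 0 := by rwa [hbx, Ne, CStarRing.star_mul_self_eq_zero_iff]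
  obtain ⟨t, ht, ht0⟩ : ∃ t ∈ spectrum ℝ b, t ≠ 0 := by
    by_contra! h
    exact hb0 (CFC.eq_zero_of_spectrum_subset_zero (R := ℝ) b h)
  have htpos : 0 < t := lt_of_le_of_ne (spectrum_star_mul_self_nonneg t ht) ht0.symm
  set f : ℝ → ℝ := fun s => max (s - t / 2) 0 with hf
  set g : ℝ → ℝ := fun s => (√(max s (t / 2)))⁻¹ with hg
  have hpos : ∀ s, 0 < max s (t / 2) := fun s => lt_max_of_lt_right (by positivity)
  have hfc : Continuous f := by fun_prop
  have hgc : Continuous g := by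
    refine Continuous.inv₀ (by fun_prop) fun s => ?_
    exact (Real.sqrt_pos.2 (hpos s)).ne'
  set F := cfc f b with hF
  set c := cfc g b with hc
  have hcs : star c = c := (cfc_predicate g b : IsSelfAdjoint c)
  have hFc : Commute F c := cfc_commute_cfc f g b
  have hbid : cfc (id : ℝ → ℝ) b = b := cfc_id ℝ b
  have hFb : Commute F b := by
    have := cfc_commute_cfc f id b
    rwa [hbid] at this
  have hcb : Commute c b := by
    have := cfc_commute_cfc g id b
    rwa [hbid] at this
  have hcbc : F * (c * b * c) = F := by
    have h1 : cfc (fun s => f s * (g s * id s * g s)) b = F * (c * b * c) := by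
      rw [cfc_mul f _ b hfc.continuousOn (by fun_prop), cfc_mul _ g b (by fun_prop)
        hgc.continuousOn, cfc_mul g id b hgc.continuousOn (by fun_prop), hbid]
    rw [← h1, hF]
    congr 1
    ext s
    simp only [hf, hg, id]
    rcases le_total s (t / 2) with h | h
    · rw [max_eq_right (by linarith : s - t / 2 ≤ 0), zero_mul]
    · rw [max_eq_left h]
      have : 0 < s := by linarith
      have h3 : √s * √s = s := Real.mul_self_sqrt this.le
      have h4 : √s ≠ 0 := (Real.sqrt_pos.2 this).ne'
      field_simp
      rw [sq, h3, mul_comm]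
  have hF0 : F ≠ 0 := by
    intro h
    have h1 : f t ∈ spectrum ℝ F := by
      rw [hF, cfc_map_spectrum f b hb hfc.continuousOn]
      exact ⟨t, ht, rfl⟩
    rw [h] at h1
    have : Nontrivial A := ⟨b, 0, hb0⟩
    rw [spectrum.zero_eq, Set.mem_singleton_iff] at h1
    simp only [hf] at h1
    rw [max_eq_left (by linarith)] at h1
    linarith
  obtain ⟨q, hq⟩ := hA.exists_isRightSupport (fun _ : Unit => F)
  have hqc : Commute q c := hq.commute hcs fun _ => hFc
  have hqb : Commute q b := hq.commute hb.star_eq fun _ => hFb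
  have hq1 : q * (c * b * c) = q := by
    have : q * (c * b * c - 1) = 0 := by
      rw [hq.2]
      intro
      rw [mul_sub, hcbc, mul_one, sub_self]
    rwa [mul_sub, mul_one, sub_eq_zero] at this
  have hq0 : q ≠ 0 := by
    intro h
    apply hF0
    have := hq.mul_self ()
    rwa [h, mul_zero, eq_comm] at this
  have hqq : q * q = q := hq.1.2
  have hww : star (x * c * q) * (x * c * q) = q := by
    calc star (x * c * q) * (x * c * q) = q * (c * b * c) * q := by
          simp only [star_mul, hcs, hq.1.1, hbx, mul_assoc]
      _ = q := by rw [hq1, hqq]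
  refine ⟨x * c * q, ?_, ?_, ⟨c * q, by rw [mul_assoc]⟩,
    ⟨x * c * q * c * c * star x, ?_⟩, ?_⟩
  · intro h
    rw [h, mul_zero] at hww
    exact hq0 hww.symm
  · rw [mul_assoc, hww, mul_assoc, hqq]
  · calc x * c * q = x * c * (q * (c * b * c)) := by rw [hq1]
      _ = x * c * (q * (c * (c * b))) := by rw [mul_assoc c b c, ← hcb.eq]
      _ = _ := by simp only [hbx, mul_assoc]
  · rw [hww]
    calc x * c * q * star (x * c * q) * x = x * (c * (q * q) * (c * b)) := by
          simp only [star_mul, hcs, hq.1.1, hbx, mul_assoc]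
      _ = x * (q * (c * b * c)) := by rw [hqq, ← hqc.eq, mul_assoc q, mul_assoc c b c, ← hcb.eq]
      _ = _ := by rw [hq1]

end Cutdown

section TwoProjections

variable {A : Type*} [CStarAlgebra A]

theorem mul_eq_zero_of_sq_eq {s k y : A} (hk : star k = k) (hks : k * k = s * s)
    (h : s * y = 0) : k * y = 0 := by
  rw [← CStarRing.star_mul_self_eq_zero_iff, star_mul, hk, mul_assoc, ← mul_assoc k k, hks,
    mul_assoc s, h, mul_zero, mul_zero]

/-- A self-adjoint square root of the square of a self-adjoint element. -/
theorem exists_abs {s : A} (hs : star s = s) :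
    ∃ k : A, star k = k ∧ k * k = s * s ∧ ∀ z, Commute (s * s) z → Commute k z := by
  have hss : IsSelfAdjoint (s * s) := by rw [IsSelfAdjoint, star_mul, hs]
  refine ⟨cfc Real.sqrt (s * s), (cfc_predicate Real.sqrt (s * s) : IsSelfAdjoint _), ?_,
    fun z hz => hz.cfc_real _⟩
  rw [← cfc_mul _ _ (s * s) (by fun_prop) (by fun_prop)]
  conv_rhs => rw [← cfc_id ℝ (s * s)]
  refine cfc_congr fun t ht => ?_
  have := spectrum_star_mul_self_nonneg (b := s) t (by rwa [hs])
  simp [Real.mul_self_sqrt this]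

/-- The polar decomposition of a self-adjoint element in an AW*-algebra. -/
theorem IsAWStar.exists_symmetry (hA : IsAWStar A) {s k : A} (hs : star s = s) (hk : star k = k)
    (hks : k * k = s * s) (hc : Commute k s) :
    ∃ u : A, star u = u ∧ k * u = s ∧ u * k = s ∧ IsRightSupport (fun _ : Unit => s) (u * u) ∧
      u * u * u = u := by
  obtain ⟨a, ha⟩ := hA.exists_isRightSupport (fun _ : Unit => k + s)
  obtain ⟨b, hb⟩ := hA.exists_isRightSupport (fun _ : Unit => k - s)
  have hsk : s * k = k * s := hc.eq.symm
  have h1 : a * (k - s) = 0 := by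
    rw [ha.2]
    intro
    grind [mul_sub, sub_mul, mul_add, add_mul]
  have h2 : b * (k + s) = 0 := by
    rw [hb.2]
    intro
    grind [mul_sub, sub_mul, mul_add, add_mul]
  have h1' : (k - s) * a = 0 :=
    mul_eq_zero_of_selfAdjoint ha.1.1 (by rw [star_sub, hk, hs]) h1
  have h2' : (k + s) * b = 0 :=
    mul_eq_zero_of_selfAdjoint hb.1.1 (by rw [star_add, hk, hs]) h2
  have hba : b * a = 0 := by rw [hb.2]; exact fun _ => h1'
  have hab : a * b = 0 := by rw [ha.2]; exact fun _ => h2'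
  have h3 : (k + s) * a = k + s := ha.mul_self ()
  have h4 : (k - s) * b = k - s := hb.mul_self ()
  have haa := ha.1.2
  have hbb := hb.1.2
  have huu : (a - b) * (a - b) = a + b := by grind [mul_sub, sub_mul, mul_add, add_mul]
  have two : ∀ x y : A, x + x = y + y → x = y := fun x y h => by
    rw [← two_smul ℂ, ← two_smul ℂ] at h
    exact smul_right_injective A two_ne_zero h
  have hku : k * (a - b) = s := two _ _ (by grind [mul_sub, sub_mul, mul_add, add_mul])
  have hus : star (a - b) = a - b := by rw [star_sub, ha.1.1, hb.1.1]
  refine ⟨a - b, hus, hku, ?_, ?_, ?_⟩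
  · have := congrArg star hku
    rwa [star_mul, hus, hk, hs] at this
  · rw [huu, isRightSupport_unit]
    refine ⟨ha.1.add hb.1 hab, fun y => ⟨fun h => ?_, fun h => ?_⟩⟩
    · have : s * (a + b) = s := two _ _ (by grind [mul_sub, sub_mul, mul_add, add_mul])
      rw [← this, mul_assoc, h, mul_zero]
    · have hky := mul_eq_zero_of_sq_eq hk hks h
      rw [add_mul, (ha.2 y).2, (hb.2 y).2, add_zero] <;> intro
      · rw [sub_mul, h, hky, sub_zero]
      · rw [add_mul, h, hky, add_zero]
  · rw [huu]
    grind [mul_sub, sub_mul, mul_add, add_mul]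

/-- Any two projections split, along a projection commuting with both, into equivalent parts
and orthogonal parts. -/
theorem IsAWStar.exists_split (hA : IsAWStar A) {e f : A} (he : IsProjection e)
    (hf : IsProjection f) :
    ∃ r : A, IsProjection r ∧ e * r = r * e ∧ f * r = r * f ∧ MvNEquiv (e * r) (f * r) ∧
      e * (1 - r) * (f * (1 - r)) = 0 := by
  obtain ⟨s, hsdef⟩ : ∃ s, s = e + f - 1 := ⟨_, rfl⟩
  have hs : star s = s := by rw [hsdef, star_sub, star_add, he.1, hf.1, star_one]
  have hee := he.2
  have hff := hf.2
  have hse : s * e = f * s := by grind [mul_sub, sub_mul, mul_add, add_mul]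
  have hsf : s * f = e * s := by grind [mul_sub, sub_mul, mul_add, add_mul]
  obtain ⟨k, hk, hks, hkc⟩ := exists_abs hs
  have hke : k * e = e * k := hkc e <| by
    rw [Commute, SemiconjBy]
    grind [mul_sub, sub_mul, mul_add, add_mul]
  have hkf : k * f = f * k := hkc f <| by
    rw [Commute, SemiconjBy]
    grind [mul_sub, sub_mul, mul_add, add_mul]
  obtain ⟨u, hu, hku, huk, hr, huu⟩ := hA.exists_symmetry hs hk hks (hkc s <| by
    rw [Commute, SemiconjBy, mul_assoc])
  obtain ⟨r, hrdef⟩ : ∃ r, r = u * u := ⟨_, rfl⟩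
  rw [← hrdef] at hr huu
  have hrr := hr.1.2
  have hsr : s * r = s := hr.mul_self ()
  have key : ∀ x y : A, s * x = y * s → r * x = r * x * r := by
    intro x y h
    have : r * (x * (1 - r)) = 0 := by
      rw [hr.2]
      intro
      rw [← mul_assoc, h, mul_assoc, mul_sub, mul_one, hsr, sub_self, mul_zero]
    rw [mul_sub, mul_one, mul_sub, sub_eq_zero] at this
    rw [mul_assoc, ← this]
  have her : e * r = r * e := by
    have h1 := key e f hse
    have h2 := congrArg star h1
    simp only [star_mul, he.1, hr.1.1] at h2
    rw [h1, h2, mul_assoc]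
  have hfr : f * r = r * f := by
    have h1 := key f e hsf
    have h2 := congrArg star h1
    simp only [star_mul, hf.1, hr.1.1] at h2
    rw [h1, h2, mul_assoc]
  have hue : u * e = f * u := by
    have h1 : k * (u * e - f * u) = 0 := by
      rw [mul_sub, ← mul_assoc, hku, ← mul_assoc, hkf, mul_assoc, hku, hse, sub_self]
    have h2 : r * (u * e - f * u) = 0 := by
      rw [hr.2]
      exact fun _ => mul_eq_zero_of_sq_eq hs hks.symm h1
    rwa [mul_sub, sub_eq_zero, ← mul_assoc, ← mul_assoc, huu, ← hfr, mul_assoc f, huu] at h2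
  refine ⟨r, hr.1, her, hfr, MvNEquiv.symm ⟨u * e, ?_, ?_⟩, ?_⟩
  · calc u * e * star (u * e) = u * (e * e) * u := by
          simp only [star_mul, hu, he.1, mul_assoc]
      _ = f * r := by rw [hee, hue, mul_assoc, hrdef]
  · calc star (u * e) * (u * e) = e * (u * u) * e := by
          simp only [star_mul, hu, he.1, mul_assoc]
      _ = e * r := by rw [← hrdef, her, mul_assoc, hee]
  · have h1 : (e + f - 1) * (1 - r) = 0 := by
      rw [← hsdef, mul_sub, mul_one, hsr, sub_self]
    have h2 : f * (1 - r) = (1 - r) * f := by rw [mul_sub, sub_mul, hfr, mul_one, one_mul]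
    have h3 : e * (f * (1 - r)) = 0 := by
      calc e * (f * (1 - r)) = e * ((e + f - 1) * (1 - r)) + (e - e * e) * (1 - r) := by
            noncomm_ring
        _ = 0 := by rw [h1, hee, mul_zero, sub_self, zero_mul, add_zero]
    rw [mul_assoc, ← mul_assoc (1 - r), ← h2, mul_assoc f, hr.1.one_sub.2, h3]

end TwoProjections

/-- Murray–von Neumann subequivalence. -/
def MvNLe {A : Type*} [Mul A] [Star A] (p q : A) : Prop :=
  ∃ t : A, MvNEquiv p t ∧ q * t = t

section Comparison

variable {A : Type*} [CStarAlgebra A]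

theorem Orthog.symm {a b : A} (h : Orthog a b) : Orthog b a := by
  obtain ⟨h1, h2⟩ := h
  exact ⟨by simpa using congrArg star h1, by simpa using congrArg star h2⟩

theorem IsRightSupport.mul_eq_of_forall {ι : Type*} {w : ι → A} {p q : A}
    (hp : IsRightSupport w p) (hq : star q = q) (h : ∀ i, w i * q = w i) :
    q * p = p ∧ p * q = p := by
  have h1 : p * (1 - q) = 0 := by
    rw [hp.2]
    intro i
    rw [mul_sub, mul_one, h, sub_self]
  rw [mul_sub, mul_one, sub_eq_zero, eq_comm] at h1
  refine ⟨?_, h1⟩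
  have := congrArg star h1
  rwa [star_mul, hp.1.1, hq] at this

theorem IsLeftSupport.mul_eq_of_forall {ι : Type*} {w : ι → A} {p q : A}
    (hp : IsLeftSupport w p) (hq : star q = q) (h : ∀ i, q * w i = w i) :
    q * p = p ∧ p * q = p :=
  IsRightSupport.mul_eq_of_forall hp hq fun i => by
    have := congrArg star (h i)
    rwa [star_mul, hq] at this

/-- The central support of a family of elements. -/
theorem IsAWStar.exists_centralSupport (hA : IsAWStar A) {ι : Type*} (w : ι → A) :
    ∃ g : A, IsCentralProjection g ∧ (∀ i, w i * g = w i) ∧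
      ∀ y, g * y = 0 ↔ ∀ i a, w i * a * y = 0 := by
  obtain ⟨g, hg⟩ := hA.exists_isRightSupport (fun i : ι × A => w i.1 * i.2)
  have h1 : ∀ b, g * b = g * b * g := fun b => by
    have : g * (b * (1 - g)) = 0 := by
      rw [hg.2]
      rintro ⟨i, a⟩
      have := hg.mul_self (i, a * b)
      simp only [← mul_assoc] at this
      simp only [← mul_assoc, mul_sub, mul_one, this, sub_self]
    rwa [mul_sub, mul_one, mul_sub, sub_eq_zero, ← mul_assoc] at this
  refine ⟨g, ⟨hg.1, fun b => ?_⟩, fun i => ?_, fun y => ?_⟩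
  · have := congrArg star (h1 (star b))
    simp only [star_mul, star_star, hg.1.1] at this
    rw [h1, this, mul_assoc]
  · simpa using hg.mul_self (i, 1)
  · simp [hg.2]

/-- General comparability of projections. -/
theorem IsAWStar.exists_comparison (hA : IsAWStar A) {e f : A} (he : IsProjection e)
    (hf : IsProjection f) :
    ∃ h : A, IsCentralProjection h ∧ MvNLe (h * e) (h * f) ∧
      MvNLe ((1 - h) * f) ((1 - h) * e) := by
  obtain ⟨r, hr, her, hfr, hefr, hef⟩ := hA.exists_split he hf
  have her' : e * (1 - r) = (1 - r) * e := by rw [mul_sub, sub_mul, her, mul_one, one_mul]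
  have hfr' : f * (1 - r) = (1 - r) * f := by rw [mul_sub, sub_mul, hfr, mul_one, one_mul]
  have he0 : IsProjection (e * (1 - r)) := he.mul_of_comm hr.one_sub her'
  have hf0 : IsProjection (f * (1 - r)) := hf.mul_of_comm hr.one_sub hfr'
  have her0 : e * r * (e * (1 - r)) = 0 := by
    rw [her', mul_assoc, ← mul_assoc r, mul_sub, mul_one, hr.2, sub_self, zero_mul, mul_zero]
  have hfr0 : f * r * (f * (1 - r)) = 0 := by
    rw [hfr', mul_assoc, ← mul_assoc r, mul_sub, mul_one, hr.2, sub_self, zero_mul, mul_zero]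
  have hesum : e = e * r + e * (1 - r) := by noncomm_ring
  have hfsum : f = f * r + f * (1 - r) := by noncomm_ring
  have herp : IsProjection (e * r) := he.mul_of_comm hr her
  have hfrp : IsProjection (f * r) := hf.mul_of_comm hr hfr
  generalize e * (1 - r) = e0 at *
  generalize f * (1 - r) = f0 at *
  obtain ⟨V, hV, hVo, hVm⟩ := exists_maximal_pairwise
    (fun v : A => v ≠ 0 ∧ v * star v * v = v ∧ e0 * v = v ∧ v * f0 = v) Orthog
    (fun _ _ => Orthog.symm)
  have hw : OrthPartialIsometries (fun v : V => (v : A)) :=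
    ⟨fun v => (hV v v.2).2.1, fun v v' hne => hVo v.2 v'.2 (Subtype.coe_injective.ne hne)⟩
  obtain ⟨e1, he1⟩ := hA.exists_isLeftSupport (fun v : V => (v : A))
  obtain ⟨f1, hf1⟩ := hA.exists_isRightSupport (fun v : V => (v : A))
  have hfe1 : f0 * f1 = f1 ∧ f1 * f0 = f1 := hf1.mul_eq_of_forall hf0.1 fun v => (hV v v.2).2.2.2
  have hee1 : e0 * e1 = e1 ∧ e1 * e0 = e1 := he1.mul_eq_of_forall he0.1 fun v => (hV v v.2).2.2.1
  have hef1 : MvNEquiv e1 f1 :=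
    hw.mvnEquiv_of_mul_eq_zero hA he1 hf1 (mul_eq_zero_of_mul_eq_zero hee1.2 hfe1.1 hef)
  have hmax : ∀ a, (e0 - e1) * a * (f0 - f1) = 0 := by
    intro a
    by_contra hne
    obtain ⟨w, hw0, hww, ⟨c, hwc⟩, ⟨d, hwd⟩, -⟩ := hA.exists_partialIsometry_of_ne_zero hne
    have h1 : (e0 - e1) * w = w := by
      rw [hwc]
      simp only [← mul_assoc]
      congr 3
      rw [sub_mul, mul_sub, mul_sub, he0.2, hee1.1, hee1.2, he1.1.2, sub_self, sub_zero]
    have h2 : w * (f0 - f1) = w := by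
      rw [hwd]
      simp only [mul_assoc]
      congr 3
      rw [sub_mul, mul_sub, mul_sub, hf0.2, hfe1.1, hfe1.2, hf1.1.2, sub_self, sub_zero]
    have h3 : e1 * w = 0 := by
      rw [← h1, ← mul_assoc, mul_sub, hee1.2, he1.1.2, sub_self, zero_mul]
    have hwV : w ∈ V := by
      refine hVm w ⟨hw0, hww, ?_, ?_⟩ fun v hv => ⟨?_, ?_⟩
      · rw [← h1, ← mul_assoc, mul_sub, he0.2, hee1.1]
      · rw [← h2, mul_assoc, sub_mul, hf0.2, hfe1.2]
      · have h4 : f1 * star v = star v := hf1.mul_star_eq ⟨v, hv⟩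
        have h5 : f0 * star v = star v := by rw [← h4, ← mul_assoc, hfe1.1]
        rw [← h2, mul_assoc, sub_mul, h4, h5, sub_self, mul_zero]
      · have h4 : star v * e1 = star v := he1.star_mul_eq ⟨v, hv⟩
        rw [← h4, mul_assoc, h3, mul_zero]
    exact hw0 ((he1.self_mul ⟨w, hwV⟩).symm.trans h3)
  obtain ⟨g, hg, hge, hgf⟩ := hA.exists_centralSupport (fun _ : Unit => e0 - e1)
  have hge' : g * (e0 - e1) = e0 - e1 := by rw [hg.2, hge ()]
  have hgf' : g * (f0 - f1) = 0 := by
    rw [hgf]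
    exact fun _ => hmax
  have here1 : e * r * e1 = 0 := by rw [← hee1.1, ← mul_assoc, her0, zero_mul]
  have hfrf1 : f * r * f1 = 0 := by rw [← hfe1.1, ← mul_assoc, hfr0, zero_mul]
  have hequiv : MvNEquiv (e * r + e1) (f * r + f1) :=
    hefr.add herp he1.1 hef1 here1 hfrf1
  have heP : e * (e * r + e1) = e * r + e1 := by
    rw [mul_add, ← mul_assoc, he.2]
    congr 1
    rw [hesum, add_mul, here1, hee1.1, zero_add]
  have hfP : f * (f * r + f1) = f * r + f1 := by
    rw [mul_add, ← mul_assoc, hf.2]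
    congr 1
    rw [hfsum, add_mul, hfrf1, hfe1.1, zero_add]
  have key : ∀ {z x y : A}, IsCentralProjection z → y * x = x → z * y * (z * x) = z * x := by
    intro z x y hz hyx
    rw [mul_assoc, ← mul_assoc y, ← hz.2, ← mul_assoc, ← mul_assoc, hz.1.2, mul_assoc, hyx]
  refine ⟨1 - g, hg.one_sub, ⟨(1 - g) * (f * r + f1), ?_, key hg.one_sub hfP⟩, ?_⟩
  · have : (1 - g) * e = (1 - g) * (e * r + e1) := by
      rw [← sub_eq_zero, ← mul_sub]
      calc (1 - g) * (e - (e * r + e1)) = (1 - g) * (e0 - e1) := by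
            rw [sub_add_eq_sub_sub, sub_eq_of_eq_add' hesum]
        _ = 0 := by rw [sub_mul, one_mul, hge', sub_self]
    rw [this]
    exact hequiv.central_mul hg.one_sub
  · rw [sub_sub_cancel]
    refine ⟨g * (e * r + e1), ?_, key hg heP⟩
    have : g * f = g * (f * r + f1) := by
      rw [← sub_eq_zero, ← mul_sub]
      calc g * (f - (f * r + f1)) = g * (f0 - f1) := by
            rw [sub_add_eq_sub_sub, sub_eq_of_eq_add' hfsum]
        _ = 0 := hgf'
    rw [this]
    exact hequiv.symm.central_mul hg

/-- In a finite AW*-algebra, complements of equivalent projections are equivalent. -/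
theorem MvNEquiv.one_sub (hA : IsAWStar A) (hfin : IsFiniteCStar A) {l r : A}
    (hl : IsProjection l) (h : MvNEquiv l r) : MvNEquiv (1 - l) (1 - r) := by
  have main : ∀ {z l r : A}, IsCentralProjection z → IsProjection l → MvNEquiv l r →
      MvNLe (z * (1 - l)) (z * (1 - r)) → MvNEquiv (z * (1 - l)) (z * (1 - r)) := by
    intro z l r hz hl h ⟨t, hlt, htr⟩
    have hr := h.isProjection_right hl
    have hzl := hz.1.mul_of_comm hl (hz.2 _)
    have hzr := hz.1.mul_of_comm hr (hz.2 _)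
    have hzl' := hz.1.mul_of_comm hl.one_sub (hz.2 _)
    have ht := hlt.isProjection_right hzl'
    have hortho : ∀ {p}, IsProjection p → z * p * (z * (1 - p)) = 0 := by
      intro p hp
      rw [hz.2 (1 - p), ← mul_assoc, mul_assoc z, mul_sub, mul_one, hp.2, sub_self, mul_zero,
        zero_mul]
    have hrt : z * r * t = 0 := by rw [← htr, ← mul_assoc, hortho hr, zero_mul]
    have h1 := (h.central_mul hz).add hzl hzl' hlt (hortho hl) hrt
    rw [← mul_add, add_sub_cancel, mul_one] at h1
    have h2 : z * t = t := by
      rw [← htr, ← mul_assoc, ← mul_assoc, hz.1.2]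
    have h3 := hfin.eq_of_mvnEquiv hz.1 (hzr.add ht hrt) h1 (by
      rw [mul_add, ← mul_assoc, hz.1.2, h2])
    have h4 : t = z * (1 - r) := by
      rw [mul_sub, mul_one, eq_sub_iff_add_eq, add_comm]
      exact h3
    rwa [h4] at hlt
  have hr := h.isProjection_right hl
  obtain ⟨z, hz, h1, h2⟩ := hA.exists_comparison hl.one_sub hr.one_sub
  have h1' := main hz hl h h1
  have h2' := (main hz.one_sub hr h.symm h2).symm
  have hortho : ∀ p, z * p * ((1 - z) * p) = 0 := fun p => by
    rw [hz.2, mul_assoc, ← mul_assoc z, mul_sub, hz.1.2, mul_one, sub_self, zero_mul, mul_zero]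
  have h3 := h1'.add (hz.1.mul_of_comm hl.one_sub (hz.2 _))
    (hz.one_sub.1.mul_of_comm hl.one_sub (hz.one_sub.2 _)) h2' (hortho _) (hortho _)
  rwa [← add_mul, ← add_mul, add_sub_cancel, one_mul, one_mul] at h3

end Comparison

section FiniteAdditivity

variable {A : Type*} [CStarAlgebra A]

theorem OrthPartialIsometries.star_mul_of_ne {ι : Type*} {w : ι → A}
    (hw : OrthPartialIsometries w) {i j : ι} (h : i ≠ j) : star (w i) * w j = 0 :=
  (hw.2 j i h.symm).2

theorem OrthPartialIsometries.mul_star_of_ne {ι : Type*} {w : ι → A}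
    (hw : OrthPartialIsometries w) {i j : ι} (h : i ≠ j) : w i * star (w j) = 0 :=
  (hw.2 i j h).1

theorem IsCentralProjection.mul_mul_mul {z : A} (hz : IsCentralProjection z) (x y : A) :
    z * x * (z * y) = z * (x * y) := by
  rw [mul_assoc, ← mul_assoc x, ← hz.2, ← mul_assoc, ← mul_assoc, hz.1.2, mul_assoc]

theorem IsCentralProjection.isProjection_mul {z p : A} (hz : IsCentralProjection z)
    (hp : IsProjection p) : IsProjection (z * p) :=
  hz.1.mul_of_comm hp (hz.2 p)

theorem MvNEquiv.of_central {z p q : A} (hz : IsCentralProjection z) (hp : IsProjection p)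
    (h : MvNEquiv (z * p) (z * q)) (h' : MvNEquiv ((1 - z) * p) ((1 - z) * q)) :
    MvNEquiv p q := by
  have hortho : ∀ p, z * p * ((1 - z) * p) = 0 := fun p => by
    rw [hz.2, mul_assoc, ← mul_assoc z, mul_sub, hz.1.2, mul_one, sub_self, zero_mul, mul_zero]
  have := h.add (hz.isProjection_mul hp) (hz.one_sub.isProjection_mul hp) h' (hortho _)
    (hortho _)
  rwa [← add_mul, ← add_mul, add_sub_cancel, one_mul, one_mul] at this

theorem OrthPartialIsometries.eq_of_mvnEquiv_central (hfin : IsFiniteCStar A)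
    {ι : Type*} {w c : ι → A} (hw : OrthPartialIsometries w)
    (hc : ∀ i, IsCentralProjection (c i)) (hwc : ∀ i, w i * c i = w i)
    (hwc' : ∀ i j, i ≠ j → w i * c j = 0) {e f z t : A} (he : IsLeftSupport w e)
    (hf : IsRightSupport w f) (hz : IsCentralProjection z) (het : MvNEquiv (z * e) t)
    (hft : z * f * t = t) : t = z * f := by
  have hec : ∀ i, c i * e = w i * star (w i) := fun i => by
    have h : e * (c i - w i * star (w i)) = 0 := by
      rw [he.2]
      intro j
      have h1 : star (w j) * c i = star (w j * c i) := by rw [← (hc i).2, star_mul, (hc i).1.1]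
      rw [mul_sub, h1]
      by_cases hij : j = i
      · rw [hij, hwc, ← mul_assoc, star_mul_star_mul (hw.1 i), sub_self]
      · rw [hwc' j i hij, star_zero, ← mul_assoc, hw.star_mul_of_ne hij, zero_mul, sub_self]
    rw [mul_sub, sub_eq_zero, ← mul_assoc, he.self_mul] at h
    rw [(hc i).2, h]
  have hfc : ∀ i, c i * f = star (w i) * w i := fun i => by
    have h : f * (c i - star (w i) * w i) = 0 := by
      rw [hf.2]
      intro j
      rw [mul_sub]
      by_cases hij : j = i
      · rw [hij, hwc, ← mul_assoc, hw.1 i, sub_self]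
      · rw [hwc' j i hij, ← mul_assoc, hw.mul_star_of_ne hij, zero_mul, sub_self]
    rw [mul_sub, sub_eq_zero, ← mul_assoc, hf.mul_star_eq] at h
    rw [(hc i).2, h]
  have ht := het.isProjection_right (hz.isProjection_mul he.1)
  have hct : ∀ i, c i * t = c i * (z * f) := fun i => by
    have h1 : MvNEquiv (c i * (z * f)) (c i * (z * e)) := by
      rw [← mul_assoc, ← mul_assoc, (hc i).2, mul_assoc, mul_assoc, hec, hfc]
      exact MvNEquiv.central_mul (MvNEquiv.symm ⟨w i, rfl, rfl⟩) hz
    have h2 := (hc i).isProjection_mul (hz.isProjection_mul hf.1)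
    refine hfin.eq_of_mvnEquiv h2 ((hc i).isProjection_mul ht)
      (h1.trans h2 (het.central_mul (hc i))) ?_
    rw [(hc i).mul_mul_mul, hft]
  have h1 : f * (z * f - t) = 0 := by
    rw [hf.2]
    intro i
    rw [← hwc i, mul_assoc, mul_sub, hct, sub_self, mul_zero]
  have h2 : f * (z * f) = z * f := by rw [← mul_assoc, ← hz.2, mul_assoc, hf.1.2]
  rw [mul_sub, h2, sub_eq_zero] at h1
  rw [h1, ← hft, ← mul_assoc, h2]

/-- Centrally separated partial isometries are addable in a finite AW*-algebra. -/
theorem OrthPartialIsometries.mvnEquiv_of_central (hA : IsAWStar A) (hfin : IsFiniteCStar A)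
    {ι : Type*} {w c : ι → A} (hw : OrthPartialIsometries w)
    (hc : ∀ i, IsCentralProjection (c i)) (hwc : ∀ i, w i * c i = w i)
    (hwc' : ∀ i j, i ≠ j → w i * c j = 0) {e f : A} (he : IsLeftSupport w e)
    (hf : IsRightSupport w f) : MvNEquiv e f := by
  obtain ⟨z, hz, ⟨t, h1, h2⟩, t', h1', h2'⟩ := hA.exists_comparison he.1 hf.1
  refine MvNEquiv.of_central hz he.1 ?_ ?_
  · rwa [hw.eq_of_mvnEquiv_central hfin hc hwc hwc' he hf hz h1 h2] at h1
  · rw [hw.star_family.eq_of_mvnEquiv_central hfin hc (fun i => ?_) (fun i j hij => ?_)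
      hf.isLeftSupport_star he hz.one_sub h1' h2'] at h1'
    · exact h1'.symm
    · rw [← (hc i).1.1, ← star_mul, (hc i).2, hwc]
    · rw [← (hc j).1.1, ← star_mul, (hc j).2, hwc' i j hij, star_zero]

/-- In a finite AW*-algebra, partial isometries are addable if there is an equivalent copy of
the left support orthogonal to it, and likewise on the right. -/
theorem OrthPartialIsometries.mvnEquiv_of_copies (hA : IsAWStar A) (hfin : IsFiniteCStar A)
    {ι : Type*} {w : ι → A} (hw : OrthPartialIsometries w) {e f e' f' : A}
    (he : IsLeftSupport w e) (hf : IsRightSupport w f) (hee : MvNEquiv e e') (hee0 : e * e' = 0)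
    (hff : MvNEquiv f f') (hff0 : f * f' = 0) : MvNEquiv e f := by
  obtain ⟨z, hz, ⟨t, h1, h2⟩, t', h1', h2'⟩ := hA.exists_comparison hf.1 he.1.one_sub
  have hz' := hz.one_sub
  refine MvNEquiv.of_central hz he.1 ?_ ?_
  · refine OrthPartialIsometries.mvnEquiv_of_exists hA (w := fun i => z * w i)
      ⟨fun i => ?_, fun i j hij => ⟨?_, ?_⟩⟩ ⟨hz.isProjection_mul he.1, fun y => ?_⟩
      ⟨hz.isProjection_mul hf.1, fun y => ?_⟩ h1 ?_
    · rw [star_mul, hz.1.1, ← hz.2, hz.mul_mul_mul, hz.mul_mul_mul, hw.1]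
    · rw [star_mul, hz.1.1, ← hz.2, hz.mul_mul_mul, hw.mul_star_of_ne hij, mul_zero]
    · rw [star_mul, hz.1.1, ← hz.2, hz.mul_mul_mul, hw.star_mul_of_ne hij.symm, mul_zero]
    · rw [hz.2, mul_assoc, he.2]
      simp only [star_mul, hz.1.1, mul_assoc]
    · rw [hz.2, mul_assoc, hf.2]
      refine forall_congr' fun i => ?_
      change w i * (z * y) = 0 ↔ z * w i * y = 0
      rw [hz.2 (w i), mul_assoc]
    · rw [← h2, ← mul_assoc, hz.mul_mul_mul, mul_sub, mul_one, he.1.2, sub_self, mul_zero,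
        zero_mul]
  · generalize 1 - z = z at *
    have he' := hee.isProjection_right he.1
    have hf' := hff.isProjection_right hf.1
    have hze := hz'.isProjection_mul he.1
    have hze' := hz'.isProjection_mul he.1.one_sub
    have ht' := h1'.isProjection_right hze'
    obtain ⟨t₂, ht₂, h3, h4⟩ := h1'.exists_sub hze' (hz'.isProjection_mul he') (by
      rw [hz'.mul_mul_mul, sub_mul, one_mul, hee0, sub_zero])
    have h5 : z * f * t₂ = t₂ := by rw [← h4, ← mul_assoc, h2']
    obtain ⟨t₃, ht₃, h6, h7⟩ := (hff.central_mul hz').exists_sub (hz'.isProjection_mul hf.1)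
      ht₂ h5
    have h8 : MvNEquiv (z * e) t₃ :=
      ((hee.central_mul hz').trans hze h3).trans hze h6
    have h9 : z * (1 - e) * (z * e) = 0 := by
      rw [hz'.mul_mul_mul, sub_mul, one_mul, he.1.2, sub_self, mul_zero]
    have h10 : t' * t₃ = 0 := by
      refine mul_eq_zero_of_mul_eq_zero
        (mul_eq_left_of_mul_eq_right ht'.1 (hz'.isProjection_mul hf.1).1 h2') h7 ?_
      rw [hz'.mul_mul_mul, hff0, mul_zero]
    have h11 := h1'.add hze' hze h8 h9 h10
    rw [← mul_add, sub_add_cancel, mul_one] at h11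
    have hzz : ∀ x p : A, z * p * x = x → z * x = x := fun x p h => by
      rw [← h, ← mul_assoc, ← mul_assoc, hz'.1.2]
    have h12 := hfin.eq_of_mvnEquiv hz'.1 (ht'.add ht₃ h10) h11 (by
      rw [mul_add, hzz _ _ h2', hzz _ _ h7])
    have h13 : z * f' * t' = 0 := by
      rw [← h2', ← mul_assoc, hz'.mul_mul_mul, mul_eq_zero_of_selfAdjoint hf.1.1 hf'.1 hff0,
        mul_zero, zero_mul]
    have h14 : t₃ = z * f' := by
      calc t₃ = z * f' * (t' + t₃) := by rw [mul_add, h13, h7, zero_add]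
        _ = z * f' := by rw [h12, mul_assoc, ← hz'.2 f', ← mul_assoc, hz'.1.2]
    rw [h14] at h8
    exact h8.trans hze (hff.symm.central_mul hz')

end FiniteAdditivity

section MainAdditivity

variable {A : Type*} [CStarAlgebra A]

theorem OrthPartialIsometries.star_mul_mul {ι κ : Type*} {w : ι → A}
    (hw : OrthPartialIsometries w) {u : κ → A} {k : κ → ι}
    (hk : ∀ v, star (w (k v)) * w (k v) * u v = u v) (i : ι) (v : κ) :
    star (w i) * w (k v) * u v = u v ∧ i = k v ∨ star (w i) * w (k v) * u v = 0 ∧ i ≠ k v := by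
  by_cases h : i = k v
  · exact Or.inl ⟨by rw [h, hk], h⟩
  · exact Or.inr ⟨by rw [hw.star_mul_of_ne h, zero_mul], h⟩

/-- Composition of a family of orthogonal partial isometries with a family of orthogonal partial
isometries supported in its right supports. -/
theorem OrthPartialIsometries.comp {ι κ : Type*} {w : ι → A} (hw : OrthPartialIsometries w)
    {u : κ → A} (hu : OrthPartialIsometries u) {k : κ → ι}
    (hk : ∀ v, star (w (k v)) * w (k v) * u v = u v) :
    OrthPartialIsometries fun v => w (k v) * u v where
  mul_star_mul v := by
    calc w (k v) * u v * star (w (k v) * u v) * (w (k v) * u v)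
        = w (k v) * (u v * star (u v) * (star (w (k v)) * w (k v) * u v)) := by
          simp only [star_mul, mul_assoc]
      _ = _ := by rw [hk, hu.1]
  orthog v v' hne := by
    constructor
    · rw [star_mul, mul_assoc, ← mul_assoc (u v), hu.mul_star_of_ne hne, zero_mul, mul_zero]
    · rw [star_mul, mul_assoc, ← mul_assoc (star (w (k v')))]
      rcases hw.star_mul_mul hk (k v') v with h | h
      · rw [h.1, hu.star_mul_of_ne hne.symm]
      · rw [h.1, mul_zero]

theorem IsLeftSupport.mul_eq_zero {ι κ : Type*} {u : ι → A} {u' : κ → A} {p p' : A}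
    (hp : IsLeftSupport u p) (hp' : IsLeftSupport u' p')
    (h : ∀ i j, star (u i) * u' j = 0) : p * p' = 0 := by
  rw [hp.2]
  intro i
  have h1 : p' * u i = 0 := by
    rw [hp'.2]
    intro j
    simpa using congrArg star (h i j)
  simpa [hp'.1.1] using congrArg star h1

theorem IsProjection.add_mul_eq_zero_iff {p q y : A} (hp : IsProjection p) (hq : IsProjection q)
    (hpq : p * q = 0) : (p + q) * y = 0 ↔ p * y = 0 ∧ q * y = 0 := by
  constructor
  · intro h
    have hqp := mul_eq_zero_of_selfAdjoint hp.1 hq.1 hpq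
    constructor
    · calc p * y = p * ((p + q) * y) := by rw [← mul_assoc, mul_add, hp.2, hpq, add_zero]
        _ = 0 := by rw [h, mul_zero]
    · calc q * y = q * ((p + q) * y) := by rw [← mul_assoc, mul_add, hq.2, hqp, zero_add]
        _ = 0 := by rw [h, mul_zero]
  · rintro ⟨h1, h2⟩
    rw [add_mul, h1, h2, add_zero]

theorem mul_mul_eq_zero_iff {w u y : A} (h : star w * w * u = u) :
    w * u * y = 0 ↔ u * y = 0 := by
  constructor
  · intro h'
    rw [← h, mul_assoc, mul_assoc, ← mul_assoc w, h', mul_zero]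
  · intro h'
    rw [mul_assoc, h', mul_zero]

theorem IsRightSupport.commute_of_mul_eq {ι : Type*} {w : ι → A} {p z : A}
    (hp : IsRightSupport w p) (hz : star z = z) (hwz : ∀ i, w i * z = w i ∨ w i * z = 0) :
    z * p = p * z := by
  have h1 : p * (z * (1 - p)) = 0 := by
    rw [hp.2]
    intro i
    rw [← mul_assoc]
    rcases hwz i with h | h
    · rw [h, mul_sub, mul_one, hp.mul_self, sub_self]
    · rw [h, zero_mul]
  have h2 : p * z = p * z * p := by
    rw [mul_sub, mul_one, mul_sub, sub_eq_zero] at h1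
    rw [mul_assoc, ← h1]
  have h3 := congrArg star h2
  simp only [star_mul, hp.1.1, hz] at h3
  rw [h2, h3, mul_assoc]

/-- Orthogonal partial isometries are addable in a finite AW*-algebra. -/
theorem OrthPartialIsometries.mvnEquiv (hA : IsAWStar A) (hfin : IsFiniteCStar A)
    {ι : Type*} {w : ι → A} (hw : OrthPartialIsometries w) {e f : A}
    (he : IsLeftSupport w e) (hf : IsRightSupport w f) : MvNEquiv e f := by
  have hF : ∀ i, star (w i) * w i * (star (w i) * w i) = star (w i) * w i := fun i =>
    (isProjection_star_mul (hw.1 i)).2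
  have hFs : ∀ i, star (star (w i) * w i) = star (w i) * w i := fun i => by
    rw [star_mul, star_star]
  obtain ⟨V, hV, hVo, hVm⟩ := exists_maximal_pairwise
    (fun v : A => v ≠ 0 ∧ v * star v * v = v ∧ ∃ i j, i ≠ j ∧ star (w i) * w i * v = v ∧
      v * (star (w j) * w j) = v) (fun v v' => Orthog v v' ∧ v * v' = 0 ∧ v' * v = 0)
    (fun _ _ h => ⟨h.1.symm, h.2.2, h.2.1⟩)
  choose k l hkl hk hl using fun v : V => (hV v v.2).2.2
  have hu : OrthPartialIsometries (fun v : V => (v : A)) :=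
    ⟨fun v => (hV v v.2).2.1, fun v v' hne => (hVo v.2 v'.2 (Subtype.coe_injective.ne hne)).1⟩
  have hl' : ∀ v : V, star (w (l v)) * w (l v) * star (v : A) = star (v : A) := fun v => by
    have := congrArg star (hl v)
    rwa [star_mul, hFs] at this
  have hk' : ∀ v : V, star (v : A) * (star (w (k v)) * w (k v)) = star (v : A) := fun v => by
    have := congrArg star (hk v)
    rwa [star_mul, hFs] at this
  have hFF : ∀ i j, i ≠ j → star (w i) * w i * (star (w j) * w j) = 0 := fun i j h => by
    rw [mul_assoc, ← mul_assoc (w i), hw.mul_star_of_ne h, zero_mul, mul_zero]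
  have hvv : ∀ v v' : V, (v : A) * v' = 0 := fun v v' => by
    by_cases h : v = v'
    · subst h
      exact mul_eq_zero_of_mul_eq_zero (hl v) (hk v) (hFF _ _ (hkl v).symm)
    · exact (hVo v.2 v'.2 (Subtype.coe_injective.ne h)).2.1
  have hvv' : ∀ v v' : V, star (v : A) * star (v' : A) = 0 := fun v v' => by
    rw [← star_mul, hvv, star_zero]
  obtain ⟨f₁, hf₁⟩ := hA.exists_isLeftSupport (fun v : V => (v : A))
  obtain ⟨f₂, hf₂⟩ := hA.exists_isRightSupport (fun v : V => (v : A))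
  have hf₂v : ∀ v : V, f₂ * v = 0 := fun v => by
    rw [hf₂.2]
    exact fun v' => hvv v' v
  have hf₁v : ∀ v : V, f₁ * star (v : A) = 0 := fun v => by
    rw [hf₁.2]
    exact fun v' => hvv' v' v
  have hf₂v' : ∀ v : V, star (v : A) * f₂ = 0 := fun v => by
    have := congrArg star (hf₂v v)
    rwa [star_mul, hf₂.1.1, star_zero] at this
  have hf₁v' : ∀ v : V, (v : A) * f₁ = 0 := fun v => by
    have := congrArg star (hf₁v v)
    rwa [star_mul, hf₁.1.1, star_zero, star_star] at this
  have hff : f₁ * f₂ = 0 := by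
    rw [hf₁.2]
    exact hf₂v'
  have hff₁₂ : MvNEquiv f₁ f₂ := hu.mvnEquiv_of_mul_eq_zero hA hf₁ hf₂ hff
  have ha₁ := hw.comp hu hk
  have ha₂ := hw.comp hu.star_family hl'
  obtain ⟨e₁, he₁⟩ := hA.exists_isLeftSupport (fun v : V => w (k v) * v)
  obtain ⟨e₂, he₂⟩ := hA.exists_isLeftSupport (fun v : V => w (l v) * star (v : A))
  have hfa₁ : IsRightSupport (fun v : V => w (k v) * v) f₂ :=
    ⟨hf₂.1, fun y => by rw [hf₂.2]; exact forall_congr' fun v => (mul_mul_eq_zero_iff (hk v)).symm⟩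
  have hfa₂ : IsRightSupport (fun v : V => w (l v) * star (v : A)) f₁ :=
    ⟨hf₁.1, fun y => by rw [hf₁.2]; exact forall_congr' fun v => (mul_mul_eq_zero_iff (hl' v)).symm⟩
  have hee : e₁ * e₂ = 0 := he₁.mul_eq_zero he₂ fun v v' => by
    rw [star_mul, mul_assoc, ← mul_assoc (star (w _))]
    rcases hw.star_mul_mul hl' (k v) v' with h | h
    · rw [h.1, hvv']
    · rw [h.1, mul_zero]
  have hee₁₂ : MvNEquiv e₁ e₂ := by
    have hk2 : ∀ v : V, star (w (k v)) * w (k v) * star (w (l v) * star (v : A)) =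
        star (w (l v) * star (v : A)) := fun v => by
      rw [star_mul, star_star, ← mul_assoc, hk]
    refine (hw.comp ha₂.star_family hk2).mvnEquiv_of_mul_eq_zero hA
      ⟨he₁.1, fun y => ?_⟩ ⟨he₂.1, fun y => ?_⟩ hee
    · rw [he₁.2]
      refine forall_congr' fun v => ?_
      simp only [star_mul, star_star]
      rw [mul_assoc (w (l v))]
      exact (mul_mul_eq_zero_iff (by rw [← mul_assoc, hl'])).symm
    · rw [he₂.2]
      exact forall_congr' fun v => (mul_mul_eq_zero_iff (hk2 v)).symm
  have hef₁₂ : MvNEquiv e₁ f₂ := ha₁.mvnEquiv_of_copies hA hfin he₁ hfa₁ hee₁₂ hee hff₁₂.symm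
    (mul_eq_zero_of_selfAdjoint hf₁.1.1 hf₂.1.1 hff)
  have hef₂₁ : MvNEquiv e₂ f₁ :=
    (hee₁₂.symm.trans he₂.1 hef₁₂).trans he₂.1 hff₁₂.symm
  have hg := hf₁.1.add hf₂.1 hff
  have hcomm₁ : ∀ i, star (w i) * w i * f₁ = f₁ * (star (w i) * w i) := fun i =>
    hf₁.commute_of_mul_eq (hFs i) fun v => by
      by_cases h : i = k v
      · exact Or.inl (by rw [h, hk'])
      · exact Or.inr (by rw [← hk', mul_assoc, hFF _ _ (Ne.symm h), mul_zero])
  have hcomm₂ : ∀ i, star (w i) * w i * f₂ = f₂ * (star (w i) * w i) := fun i =>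
    hf₂.commute_of_mul_eq (hFs i) fun v => by
      by_cases h : i = l v
      · exact Or.inl (by rw [h, hl])
      · exact Or.inr (by rw [← hl, mul_assoc, hFF _ _ (Ne.symm h), mul_zero])
  have hgv : ∀ v : V, (f₁ + f₂) * v = v := fun v => by
    rw [add_mul, hf₁.self_mul, hf₂v, add_zero]
  have hvg : ∀ v : V, v * (f₁ + f₂) = v := fun v => by
    rw [mul_add, hf₁v', hf₂.mul_self, zero_add]
  have hgv' : ∀ v : V, (f₁ + f₂) * star (v : A) = star (v : A) := fun v => by
    rw [add_mul, hf₁v, hf₂.mul_star_eq, zero_add]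
  have hvg' : ∀ v : V, star (v : A) * (f₁ + f₂) = star (v : A) := fun v => by
    rw [mul_add, hf₁.star_mul_eq, hf₂v', add_zero]
  have hgf₁ : (f₁ + f₂) * f₁ = f₁ := by
    rw [add_mul, hf₁.1.2, mul_eq_zero_of_selfAdjoint hf₁.1.1 hf₂.1.1 hff, add_zero]
  have hgf₂ : (f₁ + f₂) * f₂ = f₂ := by rw [add_mul, hf₂.1.2, hff, zero_add]
  have hcomm : ∀ i, star (w i) * w i * (1 - (f₁ + f₂)) = (1 - (f₁ + f₂)) * (star (w i) * w i) :=
    fun i => by rw [mul_sub, sub_mul, mul_add, add_mul, hcomm₁, hcomm₂, mul_one, one_mul]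
  have hg' := hg.one_sub
  have hww : ∀ i, w i * (star (w i) * w i) = w i := fun i => by rw [← mul_assoc, hw.1]
  have ha₃ : OrthPartialIsometries fun i => w i * (1 - (f₁ + f₂)) := by
    refine ⟨fun i => ?_, fun i j hij => ⟨?_, ?_⟩⟩
    · calc w i * (1 - (f₁ + f₂)) * star (w i * (1 - (f₁ + f₂))) * (w i * (1 - (f₁ + f₂)))
          = w i * ((1 - (f₁ + f₂)) * (1 - (f₁ + f₂)) * (star (w i) * w i) *
              (1 - (f₁ + f₂))) := by simp only [star_mul, hg'.1, mul_assoc]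
        _ = w i * (1 - (f₁ + f₂)) := by
          rw [hg'.2, ← hcomm, mul_assoc (star (w i) * w i), hg'.2, ← mul_assoc, hww]
    · calc w i * (1 - (f₁ + f₂)) * star (w j * (1 - (f₁ + f₂)))
          = w i * ((1 - (f₁ + f₂)) * (1 - (f₁ + f₂))) * star (w j) := by
            simp only [star_mul, hg'.1, mul_assoc]
        _ = w i * (star (w i) * w i * (1 - (f₁ + f₂))) * star (w j) := by
          rw [hg'.2, ← mul_assoc, hww]
        _ = 0 := by
          rw [hcomm]
          simp only [mul_assoc]
          rw [hw.mul_star_of_ne hij, mul_zero, mul_zero, mul_zero]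
    · rw [star_mul, mul_assoc, ← mul_assoc (star (w j)), hw.star_mul_of_ne hij.symm, zero_mul,
        mul_zero]
  have hsep : ∀ i j, i ≠ j → ∀ a, w i * (1 - (f₁ + f₂)) * a * star (w j * (1 - (f₁ + f₂))) = 0 := by
    intro i j hij a
    have hx : star (w i) * w i * (1 - (f₁ + f₂)) * a * ((1 - (f₁ + f₂)) * (star (w j) * w j)) =
        0 := by
      by_contra hne
      obtain ⟨x, hx0, hxx, ⟨b, hb⟩, ⟨d, hd⟩, -⟩ := hA.exists_partialIsometry_of_ne_zero hne
      have h1 : star (w i) * w i * x = x := by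
        rw [hb]
        simp only [← mul_assoc]
        rw [star_mul_star_mul (hw.1 i)]
      have h2 : x * (star (w j) * w j) = x := by
        rw [hd, mul_assoc d, mul_assoc _ _ (star (w j) * w j), mul_assoc (1 - (f₁ + f₂)), hF]
      have h3 : (1 - (f₁ + f₂)) * x = x := by
        rw [hb, hcomm]
        simp only [← mul_assoc]
        rw [hg'.2]
      have h4 : x * (1 - (f₁ + f₂)) = x := by
        rw [hd, ← hcomm, mul_assoc d, mul_assoc _ _ (1 - (f₁ + f₂)),
          mul_assoc (star (w j) * w j), hg'.2]
      have hxV : x ∈ V := by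
        refine hVm x ⟨hx0, hxx, i, j, hij, h1, h2⟩ fun v hv => ⟨⟨?_, ?_⟩, ?_, ?_⟩
        · refine mul_eq_zero_of_mul_eq_zero h4 (hgv' ⟨v, hv⟩) ?_
          rw [sub_mul, one_mul, hg.2, sub_self]
        · refine mul_eq_zero_of_mul_eq_zero (hvg' ⟨v, hv⟩) h3 ?_
          rw [mul_sub, mul_one, hg.2, sub_self]
        · refine mul_eq_zero_of_mul_eq_zero h4 (hgv ⟨v, hv⟩) ?_
          rw [sub_mul, one_mul, hg.2, sub_self]
        · refine mul_eq_zero_of_mul_eq_zero (hvg ⟨v, hv⟩) h3 ?_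
          rw [mul_sub, mul_one, hg.2, sub_self]
      apply hx0
      have h5 : (f₁ + f₂) * x = x := hgv ⟨x, hxV⟩
      rw [← h3, sub_mul, one_mul, h5, sub_self]
    have h6 : star (w j) = star (w j) * w j * star (w j) := (star_mul_star_mul (hw.1 j)).symm
    calc w i * (1 - (f₁ + f₂)) * a * star (w j * (1 - (f₁ + f₂)))
        = w i * (star (w i) * w i) * (1 - (f₁ + f₂)) * a *
            ((1 - (f₁ + f₂)) * (star (w j) * w j * star (w j))) := by
          rw [hww, ← h6, star_mul, hg'.1]
      _ = w i * (star (w i) * w i * (1 - (f₁ + f₂)) * a *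
            ((1 - (f₁ + f₂)) * (star (w j) * w j))) * star (w j) := by simp only [mul_assoc]
      _ = 0 := by rw [hx, mul_zero, zero_mul]
  choose c hc hwc hcw using fun i =>
    hA.exists_centralSupport (fun _ : Unit => w i * (1 - (f₁ + f₂)))
  obtain ⟨e₃, he₃⟩ := hA.exists_isLeftSupport (fun i => w i * (1 - (f₁ + f₂)))
  obtain ⟨f₃, hf₃⟩ := hA.exists_isRightSupport (fun i => w i * (1 - (f₁ + f₂)))
  have hef₃ : MvNEquiv e₃ f₃ := by
    refine ha₃.mvnEquiv_of_central hA hfin hc (fun i => hwc i ()) (fun i j hij => ?_) he₃ hf₃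
    have := (hcw j (star (w i * (1 - (f₁ + f₂))))).2 fun _ => hsep j i hij.symm
    have := congrArg star this
    rwa [star_mul, star_star, star_zero, (hc j).1.1] at this
  have hf₃g : f₃ * (f₁ + f₂) = 0 := by
    rw [hf₃.2]
    intro i
    rw [mul_assoc, sub_mul, one_mul, hg.2, sub_self, mul_zero]
  have hf₃₁ : f₃ * f₁ = 0 := by rw [← hgf₁, ← mul_assoc, hf₃g, zero_mul]
  have hf₃₂ : f₃ * f₂ = 0 := by rw [← hgf₂, ← mul_assoc, hf₃g, zero_mul]
  have he₃₁ : e₃ * e₁ = 0 := he₃.mul_eq_zero he₁ fun i v => by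
    rw [star_mul, hg'.1, mul_assoc, ← mul_assoc (star (w i))]
    rcases hw.star_mul_mul hk i v with h | h
    · rw [h.1, sub_mul, one_mul, hgv, sub_self]
    · rw [h.1, mul_zero]
  have he₃₂ : e₃ * e₂ = 0 := he₃.mul_eq_zero he₂ fun i v => by
    rw [star_mul, hg'.1, mul_assoc, ← mul_assoc (star (w i))]
    rcases hw.star_mul_mul hl' i v with h | h
    · rw [h.1, sub_mul, one_mul, hgv', sub_self]
    · rw [h.1, mul_zero]
  have hf₂₁ := mul_eq_zero_of_selfAdjoint hf₁.1.1 hf₂.1.1 hff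
  have hf₃₁₂ : f₃ * (f₂ + f₁) = 0 := by rw [mul_add, hf₃₁, hf₃₂, add_zero]
  have he₃₁₂ : e₃ * (e₁ + e₂) = 0 := by rw [mul_add, he₃₁, he₃₂, add_zero]
  have hfp := hf₂.1.add hf₁.1 hf₂₁
  have hep := he₁.1.add he₂.1 hee
  have hfsum : f = f₃ + (f₂ + f₁) := by
    refine hf.unique (w' := w) ⟨hf₃.1.add hfp hf₃₁₂, fun y => ?_⟩ fun y => Iff.rfl
    rw [hf₃.1.add_mul_eq_zero_iff hfp hf₃₁₂, hf₂.1.add_mul_eq_zero_iff hf₁.1 hf₂₁, hf₃.2, hf₂.2,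
      hf₁.2]
    have hgy : (∀ v : V, (v : A) * y = 0) ∧ (∀ v : V, star (v : A) * y = 0) →
        (1 - (f₁ + f₂)) * y = y := fun h => by
      rw [sub_mul, one_mul, (hf₁.1.add_mul_eq_zero_iff hf₂.1 hff).2 ⟨(hf₁.2 y).2 h.2,
        (hf₂.2 y).2 h.1⟩, sub_zero]
    constructor
    · rintro ⟨h1, h2⟩ i
      rw [← hgy h2, ← mul_assoc, h1]
    · intro h
      have h2 : (∀ v : V, (v : A) * y = 0) ∧ (∀ v : V, star (v : A) * y = 0) := by
        constructor
        · intro v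
          rw [← hl, mul_assoc, mul_assoc, h, mul_zero, mul_zero]
        · intro v
          rw [← hk', mul_assoc, mul_assoc, h, mul_zero, mul_zero]
      refine ⟨fun i => ?_, h2⟩
      rw [mul_assoc, hgy h2, h]
  have hesum : e = e₃ + (e₁ + e₂) := by
    refine IsRightSupport.unique he (w' := fun i => star (w i))
      ⟨he₃.1.add hep he₃₁₂, fun y => ?_⟩ fun y => Iff.rfl
    rw [he₃.1.add_mul_eq_zero_iff hep he₃₁₂, he₁.1.add_mul_eq_zero_iff he₂.1 hee, he₃.2, he₁.2,
      he₂.2]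
    simp only [star_mul, star_star, hg'.1, mul_assoc]
    constructor
    · rintro ⟨h1, h2, h3⟩ i
      have h4 : star (w i) * w i * (star (w i) * y) = star (w i) * y := by
        rw [← mul_assoc, star_mul_star_mul (hw.1 i)]
      have h5 : ∀ v : V, star (v : A) * (star (w i) * y) = 0 := fun v => by
        by_cases h : i = k v
        · rw [h, h2]
        · rw [← h4, ← hk', mul_assoc, ← mul_assoc _ _ (star (w i) * y), hFF _ _ (Ne.symm h),
            zero_mul, mul_zero]
      have h6 : ∀ v : V, (v : A) * (star (w i) * y) = 0 := fun v => by
        by_cases h : i = l v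
        · rw [h, h3]
        · rw [← h4, ← hl, mul_assoc, ← mul_assoc _ _ (star (w i) * y), hFF _ _ (Ne.symm h),
            zero_mul, mul_zero]
      have h7 := (hf₁.1.add_mul_eq_zero_iff hf₂.1 hff).2 ⟨(hf₁.2 _).2 h5, (hf₂.2 _).2 h6⟩
      have h8 := h1 i
      rwa [sub_mul, one_mul, h7, sub_zero] at h8
    · intro h
      simp [h]
  rw [hfsum, hesum]
  refine hef₃.add he₃.1 hep (hef₁₂.add he₁.1 he₂.1 hef₂₁ hee hf₂₁) he₃₁₂ hf₃₁₂

end MainAdditivity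

section PeirceCondition

variable {A : Type*} [CStarAlgebra A]

theorem mul_eq_zero_of_mul_star_mul {x z : A} (h : x * star x * x * z = 0) : x * z = 0 := by
  have h1 : star x * (x * z) = 0 := by
    rw [← CStarRing.star_mul_self_eq_zero_iff]
    calc star (star x * (x * z)) * (star x * (x * z)) = star z * star x * (x * star x * x * z) := by
          simp only [star_mul, star_star, mul_assoc]
      _ = 0 := by rw [h, mul_zero]
  rw [← CStarRing.star_mul_self_eq_zero_iff, star_mul, mul_assoc, h1, mul_zero]

theorem mul_star_mul_mem_innerIdealGen (x : A) : x * star x * x ∈ innerIdealGen x :=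
  subset_closure ⟨star x, rfl⟩

theorem orthog_of_innerIdealGen {x t : A} (h : ∀ s ∈ innerIdealGen x, Orthog s t) :
    Orthog x t := by
  obtain ⟨h1, h2⟩ := h _ (mul_star_mul_mem_innerIdealGen x)
  refine ⟨mul_eq_zero_of_mul_star_mul h1, ?_⟩
  have h3 := congrArg star h2
  simp only [star_mul, star_star, star_zero] at h3
  have h4 : star x * t = 0 := mul_eq_zero_of_mul_star_mul (by simpa [mul_assoc] using h3)
  simpa using congrArg star h4

/-- In an AW*-algebra, mutually orthogonal elements have a common family of orthogonal partial
isometries whose supports carry all of them. -/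
theorem IsAWStar.exists_orthPartialIsometries (hA : IsAWStar A) {ι : Type*} {x : ι → A}
    (hx : ∀ i j, i ≠ j → Orthog (x i) (x j)) :
    ∃ (W : Set A) (l r : A), OrthPartialIsometries (fun w : W => (w : A)) ∧
      IsLeftSupport (fun w : W => (w : A)) l ∧ IsRightSupport (fun w : W => (w : A)) r ∧
      (∀ w : W, ∃ i, (∃ a, (w : A) = x i * a) ∧ ∃ a, (w : A) = a * x i) ∧
      ∀ i, l * x i = x i ∧ x i * r = x i := by
  obtain ⟨W, hW, hWo, hWm⟩ := exists_maximal_pairwise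
    (fun w : A => w * star w * w = w ∧ (∃ i, (∃ a, w = x i * a) ∧ ∃ a, w = a * x i) ∧
      ∀ i, w * star w * x i = x i * (star w * w)) Orthog (fun _ _ => Orthog.symm)
  have hw : OrthPartialIsometries (fun w : W => (w : A)) :=
    ⟨fun w => (hW w w.2).1, fun w w' hne => hWo w.2 w'.2 (Subtype.coe_injective.ne hne)⟩
  obtain ⟨l, hl⟩ := hA.exists_isLeftSupport (fun w : W => (w : A))
  obtain ⟨r, hr⟩ := hA.exists_isRightSupport (fun w : W => (w : A))
  have h1 : ∀ i, l * (x i * (1 - r)) = 0 := fun i => by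
    rw [hl.2]
    intro w
    have h2 : star (w : A) * x i = star (w : A) * x i * (star (w : A) * w) := by
      rw [mul_assoc, ← (hW w w.2).2.2 i, ← mul_assoc, ← mul_assoc,
        star_mul_star_mul (hW w w.2).1]
    have h3 : star (w : A) * w * (1 - r) = 0 := by
      have h4 : (w : A) * r = w := hr.mul_self w
      rw [mul_sub, mul_one, mul_assoc, h4, sub_self]
    change star (w : A) * (x i * (1 - r)) = 0
    rw [← mul_assoc, h2, mul_assoc, h3, mul_zero]
  have h2 : ∀ i, r * (star (x i) * (1 - l)) = 0 := fun i => by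
    rw [hr.2]
    intro w
    have h3 := congrArg star ((hW w w.2).2.2 i)
    simp only [star_mul, star_star] at h3
    have h2 : (w : A) * star (x i) = w * star (x i) * (w * star (w : A)) := by
      rw [mul_assoc, h3, ← mul_assoc, ← mul_assoc, (hW w w.2).1]
    have h4 : (w : A) * star (w : A) * (1 - l) = 0 := by
      have h5 : star (w : A) * l = star (w : A) := hl.star_mul_eq w
      rw [mul_sub, mul_one, mul_assoc, h5, sub_self]
    change (w : A) * (star (x i) * (1 - l)) = 0
    rw [← mul_assoc, h2, mul_assoc, h4, mul_zero]
  have h3 : ∀ i, l * x i = x i * r := fun i => by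
    have h4 := congrArg star (h2 i)
    simp only [star_mul, star_star, star_zero, hl.1.one_sub.1, hr.1.1] at h4
    have h5 := h1 i
    rw [mul_sub, mul_one, mul_sub, sub_eq_zero] at h5
    rw [sub_mul, one_mul, sub_mul, sub_eq_zero] at h4
    exact h5.trans ((mul_assoc l (x i) r).symm.trans h4.symm)
  have h4 : ∀ i, x i - l * x i = 0 := fun i => by
    by_contra hne
    obtain ⟨w, hw0, hww, ⟨a, ha⟩, ⟨b, hb⟩, hwy⟩ := hA.exists_partialIsometry_of_ne_zero hne
    have ha' : w = x i * ((1 - r) * a) := by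
      rw [ha, h3, ← mul_assoc, mul_sub, mul_one]
    have hb' : w = b * (1 - l) * x i := by
      rw [hb, mul_assoc, sub_mul, one_mul]
    have hlw : l * w = 0 := by
      rw [ha, ← mul_assoc, mul_sub, ← mul_assoc, hl.1.2, sub_self, zero_mul]
    have hwr : w * r = 0 := by
      rw [hb, h3, mul_assoc, sub_mul, mul_assoc, hr.1.2, sub_self, mul_zero]
    have hlw' : star w * l = 0 := by simpa [hl.1.1] using congrArg star hlw
    have hwr' : r * star w = 0 := by simpa [hr.1.1] using congrArg star hwr
    have hwW : w ∈ W := by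
      refine hWm w ⟨hww, ⟨i, ⟨_, ha'⟩, _, hb'⟩, fun j => ?_⟩ fun v hv => ⟨?_, ?_⟩
      · by_cases hij : i = j
        · subst hij
          calc w * star w * x i = w * star w * (x i - l * x i) := by
                rw [mul_sub, ← mul_assoc (w * star w), mul_assoc w _ l, hlw', mul_zero, zero_mul,
                  sub_zero]
            _ = x i * (star w * w) := by
                rw [hwy, h3, sub_mul, mul_assoc (x i), ← mul_assoc r, hwr', zero_mul, mul_zero,
                  sub_zero]
        · have h5 : star w * x j = 0 := by
            rw [ha', star_mul, mul_assoc, (hx j i (Ne.symm hij)).2, mul_zero]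
          have h6 : x j * star w = 0 := by
            rw [hb', star_mul, ← mul_assoc, (hx j i (Ne.symm hij)).1, zero_mul]
          rw [mul_assoc, h5, mul_zero, ← mul_assoc, h6, zero_mul]
      · rw [← hr.mul_star_eq ⟨v, hv⟩, ← mul_assoc, hwr, zero_mul]
      · rw [← hl.star_mul_eq ⟨v, hv⟩, mul_assoc, hlw, mul_zero]
    exact hw0 ((hl.self_mul ⟨w, hwW⟩).symm.trans hlw)
  refine ⟨W, l, r, hw, hl, hr, fun w => (hW w w.2).2.1, fun i => ?_⟩
  rw [← h3, and_self]
  exact (sub_eq_zero.1 (h4 i)).symm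

theorem innerIdealGen_subset_peirce0 {x e : A} (h : e * star e * x = 0)
    (h' : x * (star e * e) = 0) : innerIdealGen x ⊆ Peirce0 e := by
  refine closure_minimal ?_ ?_
  · rintro _ ⟨a, rfl⟩
    refine ⟨?_, ?_⟩
    · rw [← mul_assoc, ← mul_assoc, h, zero_mul, zero_mul]
    · rw [mul_assoc, h', mul_zero]
  · refine IsClosed.inter (isClosed_eq ?_ continuous_const) (isClosed_eq ?_ continuous_const) <;>
      fun_prop

/-- The inner ideal of elements annihilated, together with their adjoints, by a set. -/
def rightAnnihilatorInnerIdeal (S : Set A) : Submodule ℂ A where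
  carrier := {y | (∀ s ∈ S, s * y = 0) ∧ ∀ s ∈ S, s * star y = 0}
  add_mem' := by
    rintro a b ⟨h1, h2⟩ ⟨h3, h4⟩
    exact ⟨fun s hs => by rw [mul_add, h1 s hs, h3 s hs, add_zero],
      fun s hs => by rw [star_add, mul_add, h2 s hs, h4 s hs, add_zero]⟩
  zero_mem' := by simp
  smul_mem' := by
    rintro c a ⟨h1, h2⟩
    exact ⟨fun s hs => by rw [mul_smul_comm, h1 s hs, smul_zero],
      fun s hs => by rw [star_smul, mul_smul_comm, h2 s hs, smul_zero]⟩

theorem mem_rightAnnihilatorInnerIdeal {S : Set A} {y : A} :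
    y ∈ rightAnnihilatorInnerIdeal S ↔ (∀ s ∈ S, s * y = 0) ∧ ∀ s ∈ S, s * star y = 0 :=
  Iff.rfl

theorem isInnerIdeal_rightAnnihilatorInnerIdeal (S : Set A) :
    IsInnerIdeal (rightAnnihilatorInnerIdeal S) := by
  rintro x ⟨hx, -⟩ y ⟨-, hy⟩ a
  refine ⟨fun s hs => ?_, fun s hs => ?_⟩
  · rw [← mul_assoc, ← mul_assoc, hx s hs, zero_mul, zero_mul]
  · rw [star_mul, ← mul_assoc, hy s hs, zero_mul]

theorem IsAWStar.exists_peirce (hA : IsAWStar A) (hfin : IsFiniteCStar A) {ι : Type*} {x : ι → A}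
    (hx : ∀ i j, i ≠ j → Orthog (x i) (x j)) {J : Set A}
    (hJ : ∀ i, ∀ s ∈ innerIdealGen (x i), ∀ t ∈ J, Orthog s t) :
    ∃ e : A, IsPartialIsometry e ∧ J ⊆ Peirce2 e ∧ ∀ i, innerIdealGen (x i) ⊆ Peirce0 e := by
  obtain ⟨W, l, r, hw, hl, hr, hWx, hxlr⟩ := hA.exists_orthPartialIsometries hx
  obtain ⟨e, he1, he2⟩ := (hw.mvnEquiv hA hfin hl hr).one_sub hA hfin hl.1
  refine ⟨e, ?_, fun t ht => ?_, fun i => innerIdealGen_subset_peirce0 ?_ ?_⟩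
  · rw [IsPartialIsometry, he1]
    exact hl.1.one_sub
  · have hxt : ∀ i, Orthog (x i) t := fun i => orthog_of_innerIdealGen fun s hs => hJ i s hs t ht
    have hlt : l * t = 0 := by
      rw [hl.2]
      intro w
      obtain ⟨i, ⟨a, ha⟩, -⟩ := hWx w
      have h1 : star (x i) * t = 0 := by simpa using congrArg star (hxt i).2
      change star (w : A) * t = 0
      rw [ha, star_mul, mul_assoc, h1, mul_zero]
    have hrt : r * star t = 0 := by
      rw [hr.2]
      intro w
      obtain ⟨i, -, a, ha⟩ := hWx w
      change (w : A) * star t = 0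
      rw [ha, mul_assoc, (hxt i).1, mul_zero]
    have htr : t * r = 0 := by simpa [hr.1.1] using congrArg star hrt
    change e * star e * t * (star e * e) = t
    rw [he1, he2, sub_mul, hlt, one_mul, sub_zero, mul_sub, htr, mul_one, sub_zero]
  · rw [he1, sub_mul, one_mul, (hxlr i).1, sub_self]
  · rw [he2, mul_sub, mul_one, (hxlr i).2, sub_self]

theorem isAWStar_of_peirce {A : Type u} [CStarAlgebra A]
    (h : ∀ (ι : Type u) (x : ι → A), (∀ i j : ι, i ≠ j → Orthog (x i) (x j)) →
      ∀ J : Submodule ℂ A, IsInnerIdeal J →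
        (∀ i : ι, ∀ s ∈ innerIdealGen (x i), ∀ t ∈ (J : Set A), Orthog s t) →
        ∃ e : A, IsPartialIsometry e ∧ (J : Set A) ⊆ Peirce2 e ∧
          ∀ i : ι, innerIdealGen (x i) ⊆ Peirce0 e) : IsAWStar A := by
  intro S _
  obtain ⟨V, hV, hVo, hVm⟩ := exists_maximal_pairwise
    (fun a : A => star a = a ∧ ∀ y, (∀ s ∈ S, s * y = 0) → a * y = 0) Orthog
    (fun _ _ => Orthog.symm)
  obtain ⟨e, he, hJe, hxe⟩ := h V Subtype.val
    (fun v v' hne => hVo v.2 v'.2 (Subtype.coe_injective.ne hne))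
    (rightAnnihilatorInnerIdeal S) (isInnerIdeal_rightAnnihilatorInnerIdeal S) (by
      intro v s hs t ht
      obtain ⟨ht1, ht2⟩ := mem_rightAnnihilatorInnerIdeal.1 ht
      refine closure_minimal (t := {s | Orthog s t}) ?_ ?_ hs
      · rintro _ ⟨a, rfl⟩
        have h1 := (hV v v.2).2 _ ht2
        have h2 := congrArg star ((hV v v.2).2 _ ht1)
        rw [star_mul, (hV v v.2).1, star_zero] at h2
        refine ⟨by rw [mul_assoc, h1, mul_zero], by
          rw [← mul_assoc, ← mul_assoc, h2, zero_mul, zero_mul]⟩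
      · refine IsClosed.inter (isClosed_eq ?_ continuous_const)
          (isClosed_eq ?_ continuous_const) <;> fun_prop)
  have hp : IsProjection (e * star e) := he
  have hpR : ∀ y, (∀ s ∈ S, s * y = 0) → e * star e * y = y := by
    intro y hy
    have hyJ : y * star y ∈ rightAnnihilatorInnerIdeal S :=
      mem_rightAnnihilatorInnerIdeal.2 ⟨fun s hs => by rw [← mul_assoc, hy s hs, zero_mul],
        fun s hs => by rw [star_mul, star_star, ← mul_assoc, hy s hs, zero_mul]⟩
    have h1 : e * star e * (y * star y) * (star e * e) = y * star y := hJe hyJ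
    have h2 : e * star e * (y * star y) = y * star y := by
      rw [← h1]
      simp only [← mul_assoc]
      rw [mul_star_mul_of_isProjection_mul_star hp]
    have h3 : (y - e * star e * y) * star (y - e * star e * y) = 0 := by
      calc (y - e * star e * y) * star (y - e * star e * y)
          = (y * star y - e * star e * (y * star y)) * (1 - star (e * star e)) := by
            rw [star_sub, star_mul _ y]
            noncomm_ring
        _ = 0 := by rw [h2, sub_self, zero_mul]
    rw [CStarRing.mul_star_self_eq_zero_iff, sub_eq_zero] at h3
    exact h3.symm
  have hpx : ∀ v ∈ V, v * (e * star e) = 0 := by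
    intro v hv
    have h1 := (hxe ⟨v, hv⟩ (mul_star_mul_mem_innerIdealGen v)).1
    have h2 : v * star v * v * (e * star e) = 0 := by
      simpa [(hV v hv).1, mul_assoc] using congrArg star h1
    exact mul_eq_zero_of_mul_star_mul h2
  refine ⟨e * star e, hp, ?_⟩
  generalize e * star e = p at hp hpR hpx
  have hpS : ∀ s ∈ S, s * p = 0 := by
    intro s hs
    have hz : p * star s * s * p ∈ V := by
      refine hVm _ ⟨?_, fun y hy => ?_⟩ fun v hv => ⟨?_, ?_⟩
      · simp only [star_mul, star_star, hp.1, mul_assoc]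
      · rw [mul_assoc, hpR y hy, mul_assoc, hy s hs, mul_zero]
      · have h1 : p * v = 0 :=
          mul_eq_zero_of_selfAdjoint (hV v hv).1 hp.1 (hpx v hv)
        rw [(hV v hv).1, mul_assoc, h1, mul_zero]
      · rw [(hV v hv).1, ← mul_assoc, ← mul_assoc, ← mul_assoc, hpx v hv, zero_mul, zero_mul,
          zero_mul]
    have h1 := hpx _ hz
    rw [mul_assoc, hp.2] at h1
    rw [← CStarRing.star_mul_self_eq_zero_iff, star_mul, hp.1, ← mul_assoc, h1]
  ext y
  simp only [Set.mem_ofPred_eq]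
  constructor
  · intro hy
    exact ⟨y, (hpR y hy).symm⟩
  · rintro ⟨a, rfl⟩ s hs
    rw [← mul_assoc, hpS s hs, zero_mul]

end PeirceCondition

/-- Let `A` be a finite unital C*-algebra. Then `A` is an AW*-algebra if, and only if,
for every family `{x_i}` of mutually orthogonal elements of `A` and every inner ideal
`J ⊆ A` with `A(x_i) ⊥ J` for all `i`, there exists a partial isometry `e ∈ A`
satisfying `J ⊆ A₂(e)` and `A(x_i) ⊆ A₀(e)` for all `i`. -/
theorem finite_awstar_iff_peirce_condition_for_families {A : Type u} [CStarAlgebra A]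
    (hfin : IsFiniteCStar A) :
    IsAWStar A ↔
      ∀ (ι : Type u) (x : ι → A),
        (∀ i j : ι, i ≠ j → Orthog (x i) (x j)) →
        ∀ J : Submodule ℂ A, IsInnerIdeal J →
          (∀ i : ι, ∀ s ∈ innerIdealGen (x i), ∀ t ∈ (J : Set A), Orthog s t) →
          ∃ e : A, IsPartialIsometry e ∧ (J : Set A) ⊆ Peirce2 e ∧
            ∀ i : ι, innerIdealGen (x i) ⊆ Peirce0 e := by
  refine ⟨fun hA ι x hx J _ hJx => hA.exists_peirce hfin hx hJx, isAWStar_of_peirce⟩
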